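/- arXiv:1504.04470 — 2 statements merged into one kernel-verified Lean document; each statement's English description precedes it below -/
import Mathlib

section
/- A finite graph is a proper Helly circular-arc graph if and only if it contains no induced claw, tent S_3, net, W_4, W_5, complement of C_6, or C*_ℓ for any ℓ ≥ 4. -/
/-- A unit interval graph: vertices can be mapped to reals so that two distinct
vertices are adjacent iff their images are within distance 1. -/
def SimpleGraph.IsUnitIntervalGraph {V : Type*} (G : SimpleGraph V) : Prop :=
  ∃ f : V → ℝ, ∀ u v : V, u ≠ v → (G.Adj u v ↔ |f u - f v| ≤ 1)

/-- `f : ZMod n → V` describes a hole (induced cycle of length `n ≥ 4`) of `G`. -/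
def SimpleGraph.IsHoleOn {V : Type*} (G : SimpleGraph V) (n : ℕ) (f : ZMod n → V) : Prop :=
  4 ≤ n ∧ Function.Injective f ∧
    ∀ i j : ZMod n, (G.Adj (f i) (f j) ↔ (i = j + 1 ∨ j = i + 1))

def SimpleGraph.HasHole {V : Type*} (G : SimpleGraph V) : Prop :=
  ∃ (n : ℕ) (f : ZMod n → V), G.IsHoleOn n f

/-- A graph is chordal if it has no hole. -/
def SimpleGraph.Chordal {V : Type*} (G : SimpleGraph V) : Prop := ¬ G.HasHole

/-- `G` contains an induced copy of `H`. -/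
def SimpleGraph.HasInducedCopy {V W : Type*} (G : SimpleGraph V) (H : SimpleGraph W) : Prop :=
  ∃ f : W → V, Function.Injective f ∧ ∀ a b : W, G.Adj (f a) (f b) ↔ H.Adj a b

/-- The claw `K_{1,3}`, centered at vertex `0`. -/
def clawGraph : SimpleGraph (Fin 4) := SimpleGraph.fromRel (fun a _ => a = 0)

/-- The tent `S_3`: triangle on `0,1,2`; vertex `i+3` adjacent to `{0,1,2} \ {i}`. -/
def tentGraph : SimpleGraph (Fin 6) := SimpleGraph.fromRel (fun a b =>
  (a.val < 3 ∧ b.val < 3) ∨ (a.val < 3 ∧ 3 ≤ b.val ∧ b.val ≠ a.val + 3))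

/-- The net: triangle on `0,1,2`; pendant vertex `i+3` adjacent exactly to `i`. -/
def netGraph : SimpleGraph (Fin 6) := SimpleGraph.fromRel (fun a b =>
  (a.val < 3 ∧ b.val < 3) ∨ (a.val < 3 ∧ b.val = a.val + 3))

/-- The cycle `C_n` on `ZMod n`. -/
def cycleG (n : ℕ) : SimpleGraph (ZMod n) := SimpleGraph.fromRel (fun a b => a = b + 1)

/-- The wheel `W_n`: a cycle `C_n` plus a hub (`none`) adjacent to all cycle vertices. -/
def wheelG (n : ℕ) : SimpleGraph (Option (ZMod n)) := SimpleGraph.fromRel (fun a b =>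
  a = none ∨ ∃ i j : ZMod n, a = some i ∧ b = some j ∧ i = j + 1)

/-- `C*_n`: a cycle `C_n` plus an isolated vertex (`none`). -/
def cycleStarG (n : ℕ) : SimpleGraph (Option (ZMod n)) := SimpleGraph.fromRel (fun a b =>
  ∃ i j : ZMod n, a = some i ∧ b = some j ∧ i = j + 1)

/-- Raw data of a family of closed arcs on the circle `ℝ/Lℤ`: each vertex `v` gets the
arc traversed clockwise from (the image of) `src v` to `src v + len v`. -/
structure PreArcModel (V : Type*) where
  L : ℝ
  L_pos : 0 < L
  src : V → ℝ
  len : V → ℝ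
  len_pos : ∀ v, 0 < len v
  len_lt : ∀ v, len v < L

namespace PreArcModel

variable {V : Type*}

/-- The counterclockwise endpoint of the arc of `v`. -/
noncomputable def ccp (A : PreArcModel V) (v : V) : AddCircle A.L := (A.src v : ℝ)

/-- The clockwise endpoint of the arc of `v`. -/
noncomputable def cp (A : PreArcModel V) (v : V) : AddCircle A.L :=
  ((A.src v + A.len v : ℝ) : AddCircle A.L)

/-- The closed arc assigned to `v`, as a subset of the circle. -/
noncomputable def arc (A : PreArcModel V) (v : V) : Set (AddCircle A.L) :=
  (fun x : ℝ => (x : AddCircle A.L)) '' Set.Icc (A.src v) (A.src v + A.len v)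

/-- All endpoints of all arcs are pairwise distinct. -/
def EndpointsDistinct (A : PreArcModel V) : Prop :=
  Function.Injective (fun p : V × Bool => if p.2 then A.cp p.1 else A.ccp p.1)

/-- `A` is an arc model of the graph `G`: endpoints are pairwise distinct and two
distinct vertices are adjacent iff their arcs intersect. -/
def IsModelOf (A : PreArcModel V) (G : SimpleGraph V) : Prop :=
  A.EndpointsDistinct ∧ ∀ u v : V, u ≠ v → (G.Adj u v ↔ (A.arc u ∩ A.arc v).Nonempty)

/-- No arc is properly contained in another arc. -/
def Proper (A : PreArcModel V) : Prop := ∀ u v : V, ¬ A.arc u ⊂ A.arc v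

/-- Every set of pairwise intersecting arcs has a common point. -/
def Helly (A : PreArcModel V) : Prop :=
  ∀ S : Set V, (∀ u ∈ S, ∀ v ∈ S, (A.arc u ∩ A.arc v).Nonempty) →
    (⋂ v ∈ S, A.arc v).Nonempty

/-- The set `K_A(α)` of vertices whose arc contains the point `α`. -/
noncomputable def K (A : PreArcModel V) (α : AddCircle A.L) : Set V := {v | α ∈ A.arc v}

/-- The edge set `E→_A(α)`: edges `vu` of `G` with `v ∈ K_A(α)`, `u ∉ K_A(α)`,
and `A(v)` intersecting `A(u)` from the left (`cp v ∈ A(u)`). -/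
noncomputable def Eout (A : PreArcModel V) (G : SimpleGraph V) (α : AddCircle A.L) :
    Set (Sym2 V) :=
  {e | ∃ v u : V, e = s(v, u) ∧ G.Adj v u ∧ α ∈ A.arc v ∧ α ∉ A.arc u ∧ A.cp v ∈ A.arc u}

/-- The edge set `E→_{A - Vm}(α)` of the model obtained by removing the arcs of `Vm`. -/
noncomputable def EoutAvoid (A : PreArcModel V) (G : SimpleGraph V) (Vm : Set V)
    (α : AddCircle A.L) : Set (Sym2 V) :=
  {e | ∃ v u : V, e = s(v, u) ∧ G.Adj v u ∧ v ∉ Vm ∧ u ∉ Vm ∧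
    α ∈ A.arc v ∧ α ∉ A.arc u ∧ A.cp v ∈ A.arc u}

end PreArcModel

/-- A proper Helly circular-arc graph: a graph admitting an arc model that is both
proper and Helly. -/
def SimpleGraph.IsPHCA {V : Type*} (G : SimpleGraph V) : Prop :=
  ∃ A : PreArcModel V, A.IsModelOf G ∧ A.Proper ∧ A.Helly

/-- Adjacency pattern of a fat `W_5` among the six clique-classes: classes `0..4`
form the fat hole (consecutive classes modulo 5 are completely adjacent), class `5`
is the hub (completely adjacent to everything), and each class is a clique. -/
def fatW5Rel (p q : Fin 6) : Prop :=
  p = q ∨ p = 5 ∨ q = 5 ∨ (p.val + 1) % 5 = q.val ∨ (q.val + 1) % 5 = p.val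

/-- A fat `W_5`: vertex set partitioned into six nonempty cliques with the `W_5`
adjacency pattern between the classes. -/
def SimpleGraph.IsFatW5 {V : Type*} (G : SimpleGraph V) : Prop :=
  ∃ part : V → Fin 6, Function.Surjective part ∧
    ∀ u v : V, u ≠ v → (G.Adj u v ↔ fatW5Rel (part u) (part v))

/-- `Gb` is a maximum spanning unit interval subgraph of `G`. -/
def IsMaxSpanningUIG {V : Type*} (G Gb : SimpleGraph V) : Prop :=
  Gb ≤ G ∧ Gb.IsUnitIntervalGraph ∧
    ∀ H : SimpleGraph V, H ≤ G → H.IsUnitIntervalGraph →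
      H.edgeSet.ncard ≤ Gb.edgeSet.ncard

/-- `(Vm, Em, Ep)` is an editing set of `G`: `Em` is a set of edges of `G - Vm`,
`Ep` a set of non-edges of `G - Vm`, and deleting `Em` and adding `Ep` makes
`G - Vm` a unit interval graph. -/
def IsEditingSet {V : Type*} (G : SimpleGraph V) (Vm : Set V) (Em Ep : Set (Sym2 V)) : Prop :=
  Em ⊆ G.edgeSet ∧ (∀ e ∈ Em, ∀ x ∈ e, x ∉ Vm) ∧
  (∀ e ∈ Ep, ¬ e.IsDiag ∧ e ∉ G.edgeSet ∧ ∀ x ∈ e, x ∉ Vm) ∧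
  ((SimpleGraph.fromEdgeSet ((G.edgeSet \ Em) ∪ Ep)).induce {v | v ∉ Vm}).IsUnitIntervalGraph

namespace SimpleGraph
variable {V : Type*} {G : SimpleGraph V}

/-- Two distinct nonadjacent vertices. -/
def CoAdj (G : SimpleGraph V) (a b : V) : Prop := a ≠ b ∧ ¬ G.Adj a b

theorem CoAdj.symm {a b : V} (h : G.CoAdj a b) : G.CoAdj b a :=
  ⟨h.1.symm, fun h' => h.2 h'.symm⟩

theorem false_of_claw (hG : ¬ G.HasInducedCopy clawGraph) {c x y z : V}
    (hx : G.Adj c x) (hy : G.Adj c y) (hz : G.Adj c z)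
    (hxy : G.CoAdj x y) (hxz : G.CoAdj x z) (hyz : G.CoAdj y z) : False := by
  obtain ⟨h1, h1'⟩ := hxy
  obtain ⟨h2, h2'⟩ := hxz
  obtain ⟨h3, h3'⟩ := hyz
  have := hx.ne; have := hy.ne; have := hz.ne
  refine hG ⟨![c, x, y, z], ?_, ?_⟩
  · intro i j; fin_cases i <;> fin_cases j <;> simp <;> grind
  · intro i j; fin_cases i <;> fin_cases j <;> simp [clawGraph] <;> grind [G.adj_comm]

theorem false_of_tent (hG : ¬ G.HasInducedCopy tentGraph) {a b c x y z : V}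
    (hab : G.Adj a b) (hac : G.Adj a c) (hbc : G.Adj b c)
    (hbx : G.Adj b x) (hcx : G.Adj c x) (hay : G.Adj a y) (hcy : G.Adj c y)
    (haz : G.Adj a z) (hbz : G.Adj b z)
    (hax : G.CoAdj a x) (hby : G.CoAdj b y) (hcz : G.CoAdj c z)
    (hxy : G.CoAdj x y) (hxz : G.CoAdj x z) (hyz : G.CoAdj y z) : False := by
  unfold CoAdj at *
  refine hG ⟨![a, b, c, x, y, z], ?_, ?_⟩
  · intro i j; fin_cases i <;> fin_cases j <;> simp <;> grind [G.ne_of_adj]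
  · intro i j; fin_cases i <;> fin_cases j <;> simp [tentGraph] <;> grind [G.adj_comm]

theorem false_of_net (hG : ¬ G.HasInducedCopy netGraph) {a b c x y z : V}
    (hab : G.Adj a b) (hac : G.Adj a c) (hbc : G.Adj b c)
    (hax : G.Adj a x) (hby : G.Adj b y) (hcz : G.Adj c z)
    (hay : G.CoAdj a y) (haz : G.CoAdj a z) (hbx : G.CoAdj b x) (hbz : G.CoAdj b z)
    (hcx : G.CoAdj c x) (hcy : G.CoAdj c y)
    (hxy : G.CoAdj x y) (hxz : G.CoAdj x z) (hyz : G.CoAdj y z) : False := by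
  unfold CoAdj at *
  refine hG ⟨![a, b, c, x, y, z], ?_, ?_⟩
  · intro i j; fin_cases i <;> fin_cases j <;> simp <;> grind [G.ne_of_adj]
  · intro i j; fin_cases i <;> fin_cases j <;> simp [netGraph] <;> grind [G.adj_comm]

/-- `g 0, …, g (n - 1)` is an induced cycle of `G`. -/
def IsInducedCycle (G : SimpleGraph V) (n : ℕ) (g : ℕ → V) : Prop :=
  ∀ i j, i < j → j < n → g i ≠ g j ∧ (G.Adj (g i) (g j) ↔ j = i + 1 ∨ i = 0 ∧ j + 1 = n)

theorem _root_.ZMod.cyclic_consecutive_iff {n : ℕ} [NeZero n] (hn : 2 ≤ n) {i j : ZMod n}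
    (h : i.val < j.val) :
    (i = j + 1 ∨ j = i + 1) ↔ (j.val = i.val + 1 ∨ i.val = 0 ∧ j.val + 1 = n) := by
  have hi := ZMod.val_lt i
  have hj := ZMod.val_lt j
  have : Fact (1 < n) := ⟨hn⟩
  have key : ∀ a b : ZMod n, a = b + 1 ↔ a.val = (b.val + 1) % n := by
    intro a b
    rw [← (ZMod.val_injective n).eq_iff, ZMod.val_add, ZMod.val_one]
  rw [key, key]
  rw [Nat.mod_eq_of_lt (a := i.val + 1) (by omega)]
  rcases Nat.lt_or_ge (j.val + 1) n with h1 | h1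
  · rw [Nat.mod_eq_of_lt h1]; omega
  · have : j.val + 1 = n := by omega
    rw [this, Nat.mod_self]; omega

theorem IsInducedCycle.injective {n : ℕ} [NeZero n] {g : ℕ → V} (hg : G.IsInducedCycle n g) :
    Function.Injective fun i : ZMod n => g i.val := by
  intro i j hij
  rcases lt_trichotomy i.val j.val with h | h | h
  · exact absurd hij (hg _ _ h (ZMod.val_lt j)).1
  · exact ZMod.val_injective n h
  · exact absurd hij.symm (hg _ _ h (ZMod.val_lt i)).1

theorem IsInducedCycle.adj_iff {n : ℕ} [NeZero n] (hn : 2 ≤ n) {g : ℕ → V}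
    (hg : G.IsInducedCycle n g) (i j : ZMod n) :
    G.Adj (g i.val) (g j.val) ↔ i ≠ j ∧ (i = j + 1 ∨ j = i + 1) := by
  rcases lt_trichotomy i.val j.val with h | h | h
  · rw [(hg _ _ h (ZMod.val_lt j)).2, ZMod.cyclic_consecutive_iff hn h]
    have : i ≠ j := by rintro rfl; omega
    tauto
  · rw [ZMod.val_injective n h]; simp
  · rw [G.adj_comm, (hg _ _ h (ZMod.val_lt i)).2, or_comm (a := i = j + 1),
      ZMod.cyclic_consecutive_iff hn h]
    have : i ≠ j := by rintro rfl; omega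
    tauto

theorem IsInducedCycle.hasInducedCopy {n : ℕ} (hn : 2 ≤ n) {g : ℕ → V}
    (hg : G.IsInducedCycle n g) : G.HasInducedCopy (cycleG n) := by
  have : NeZero n := ⟨by omega⟩
  refine ⟨fun i => g i.val, hg.injective, fun i j => ?_⟩
  rw [hg.adj_iff hn]; simp [cycleG]

theorem IsInducedCycle.hasInducedCopy_wheelG {n : ℕ} (hn : 2 ≤ n) {g : ℕ → V}
    (hg : G.IsInducedCycle n g) {h : V} (hh : ∀ i < n, G.Adj h (g i)) :
    G.HasInducedCopy (wheelG n) := by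
  have : NeZero n := ⟨by omega⟩
  have hh' : ∀ i : ZMod n, G.Adj h (g i.val) := fun i => hh _ (ZMod.val_lt i)
  refine ⟨fun o => o.elim h fun i => g i.val, ?_, ?_⟩
  · rintro (_ | i) (_ | j) hij
    · rfl
    · exact absurd hij (hh' j).ne
    · exact absurd hij.symm (hh' i).ne
    · exact congrArg some (hg.injective hij)
  · rintro (_ | i) (_ | j)
    · simp
    · simpa [wheelG] using hh' j
    · simpa [wheelG] using (hh' i).symm
    · simp only [Option.elim_some, hg.adj_iff hn]
      simp [wheelG]

theorem IsInducedCycle.hasInducedCopy_cycleStarG {n : ℕ} (hn : 2 ≤ n) {g : ℕ → V}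
    (hg : G.IsInducedCycle n g) {h : V} (hh : ∀ i < n, G.CoAdj h (g i)) :
    G.HasInducedCopy (cycleStarG n) := by
  have : NeZero n := ⟨by omega⟩
  have hh' : ∀ i : ZMod n, G.CoAdj h (g i.val) := fun i => hh _ (ZMod.val_lt i)
  refine ⟨fun o => o.elim h fun i => g i.val, ?_, ?_⟩
  · rintro (_ | i) (_ | j) hij
    · rfl
    · exact absurd hij (hh' j).1
    · exact absurd hij.symm (hh' i).1
    · exact congrArg some (hg.injective hij)
  · rintro (_ | i) (_ | j)
    · simp
    · simpa [cycleStarG] using (hh' j).2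
    · simpa [cycleStarG] using (hh' i).symm.2
    · simp only [Option.elim_some, hg.adj_iff hn]
      simp [cycleStarG]

theorem isInducedCycle_four {a b c d : V}
    (hab : G.Adj a b) (hbc : G.Adj b c) (hcd : G.Adj c d) (hda : G.Adj d a)
    (hac : G.CoAdj a c) (hbd : G.CoAdj b d) :
    G.IsInducedCycle 4 fun k => (![a, b, c, d] : Fin 4 → V) (Fin.ofNat 4 k) := by
  intro i j hij hj
  unfold CoAdj at *
  interval_cases j <;> interval_cases i <;>
    simp [Fin.ofNat] <;> grind [G.adj_comm, G.ne_of_adj]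

theorem false_of_wheel_four (hG : ¬ G.HasInducedCopy (wheelG 4)) {h a b c d : V}
    (ha : G.Adj h a) (hb : G.Adj h b) (hc : G.Adj h c) (hd : G.Adj h d)
    (hab : G.Adj a b) (hbc : G.Adj b c) (hcd : G.Adj c d) (hda : G.Adj d a)
    (hac : G.CoAdj a c) (hbd : G.CoAdj b d) : False := by
  refine hG ((isInducedCycle_four hab hbc hcd hda hac hbd).hasInducedCopy_wheelG (by norm_num)
    (h := h) fun i hi => ?_)
  interval_cases i <;> assumption

theorem false_of_cycleStar_four (hG : ¬ G.HasInducedCopy (cycleStarG 4)) {h a b c d : V}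
    (ha : G.CoAdj h a) (hb : G.CoAdj h b) (hc : G.CoAdj h c) (hd : G.CoAdj h d)
    (hab : G.Adj a b) (hbc : G.Adj b c) (hcd : G.Adj c d) (hda : G.Adj d a)
    (hac : G.CoAdj a c) (hbd : G.CoAdj b d) : False := by
  refine hG ((isInducedCycle_four hab hbc hcd hda hac hbd).hasInducedCopy_cycleStarG
    (by norm_num) (h := h) fun i hi => ?_)
  interval_cases i <;> assumption

theorem false_of_wheel_five (hG : ¬ G.HasInducedCopy (wheelG 5)) {h a b c d e : V}
    (ha : G.Adj h a) (hb : G.Adj h b) (hc : G.Adj h c) (hd : G.Adj h d) (he : G.Adj h e)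
    (hab : G.Adj a b) (hbc : G.Adj b c) (hcd : G.Adj c d) (hde : G.Adj d e) (hea : G.Adj e a)
    (hac : G.CoAdj a c) (hbd : G.CoAdj b d) (hce : G.CoAdj c e) (hda : G.CoAdj d a)
    (heb : G.CoAdj e b) : False := by
  have hg : G.IsInducedCycle 5 fun k => (![a, b, c, d, e] : Fin 5 → V) (Fin.ofNat 5 k) := by
    intro i j hij hj
    unfold CoAdj at *
    interval_cases j <;> interval_cases i <;>
      simp [Fin.ofNat] <;> grind [G.adj_comm, G.ne_of_adj]
  refine hG (hg.hasInducedCopy_wheelG (by norm_num) (h := h) fun i hi => ?_)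
  interval_cases i <;> assumption

theorem false_of_prism (hG : ¬ G.HasInducedCopy (cycleG 6)ᶜ) {a b c x y z : V}
    (hab : G.Adj a b) (hac : G.Adj a c) (hbc : G.Adj b c)
    (hxy : G.Adj x y) (hxz : G.Adj x z) (hyz : G.Adj y z)
    (hax : G.Adj a x) (hby : G.Adj b y) (hcz : G.Adj c z)
    (hay : G.CoAdj a y) (haz : G.CoAdj a z) (hbx : G.CoAdj b x) (hbz : G.CoAdj b z)
    (hcx : G.CoAdj c x) (hcy : G.CoAdj c y) : False := by
  have hg : Gᶜ.IsInducedCycle 6 fun k => (![a, y, c, x, b, z] : Fin 6 → V) (Fin.ofNat 6 k) := by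
    intro i j hij hj
    unfold CoAdj at *
    interval_cases j <;> interval_cases i <;>
      simp [Fin.ofNat] <;> grind [G.adj_comm, G.ne_of_adj]
  obtain ⟨f, hf, hf'⟩ := hg.hasInducedCopy (by norm_num)
  refine hG ⟨f, hf, fun i j => ?_⟩
  rw [compl_adj, ← hf', compl_adj, hf.ne_iff]
  by_cases h : i = j
  · simp [h]
  · simp [h]

end SimpleGraph

namespace SimpleGraph
variable {V : Type*} {G : SimpleGraph V}

/-- None of the forbidden graphs is an induced subgraph. -/
structure ForbiddenFree (G : SimpleGraph V) : Prop where
  claw : ¬ G.HasInducedCopy clawGraph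
  tent : ¬ G.HasInducedCopy tentGraph
  net : ¬ G.HasInducedCopy netGraph
  wheel_four : ¬ G.HasInducedCopy (wheelG 4)
  wheel_five : ¬ G.HasInducedCopy (wheelG 5)
  prism : ¬ G.HasInducedCopy (cycleG 6)ᶜ
  cycleStar : ∀ n : ℕ, 4 ≤ n → ¬ G.HasInducedCopy (cycleStarG n)

/-- A two-colouring of the neighbourhood of `v` whose classes are cliques. -/
def IsLocalColoring (G : SimpleGraph V) (v : V) (t : V → Bool) : Prop :=
  ∀ a b, G.Adj v a → G.Adj v b → G.CoAdj a b → t a ≠ t b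

/-- `c` is a neighbour of `v` that misses another neighbour of `v`. -/
def Split (G : SimpleGraph V) (v c : V) : Prop :=
  G.Adj v c ∧ ∃ d, G.Adj v d ∧ G.CoAdj c d

theorem adj_of_not_split {u v c : V} (huv : G.Adj u v) (h : ¬ G.Split u v) (hc : G.Adj u c)
    (hcv : c ≠ v) : G.Adj v c := by
  by_contra h'
  exact h ⟨huv, c, hc, hcv.symm, h'⟩

theorem Split.of_not_split {u v c : V} (huv : G.Adj u v) (h : ¬ G.Split u v) (hc : G.Split u c) :
    G.Split v c := by
  obtain ⟨hc, d, hd, hcd⟩ := hc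
  refine ⟨adj_of_not_split huv h hc ?_, d, adj_of_not_split huv h hd ?_, hcd⟩
  · rintro rfl; exact h ⟨huv, d, hd, hcd⟩
  · rintro rfl; exact h ⟨huv, c, hc, hcd.symm⟩

theorem IsLocalColoring.of_not_split {u v : V} {t : V → Bool} (ht : G.IsLocalColoring v t)
    (huv : G.Adj u v) (h : ¬ G.Split u v) : G.IsLocalColoring u t := fun a b ha hb hab =>
  ht a b (Split.of_not_split huv h ⟨ha, b, hb, hab⟩).1
    (Split.of_not_split huv h ⟨hb, a, ha, hab.symm⟩).1 hab

theorem IsLocalColoring.xor {v : V} {t : V → Bool} (ht : G.IsLocalColoring v t) (s : Bool) :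
    G.IsLocalColoring v (fun a => xor s (t a)) := by
  intro a b ha hb hab
  have := ht a b ha hb hab
  simpa using this

namespace ForbiddenFree

variable (hG : G.ForbiddenFree)
include hG

theorem no_coTriangle {v a b c : V} (ha : G.Adj v a) (hb : G.Adj v b) (hc : G.Adj v c)
    (hab : G.CoAdj a b) (hbc : G.CoAdj b c) (hac : G.CoAdj a c) : False :=
  false_of_claw hG.claw ha hb hc hab hac hbc

theorem no_square {v a b c d : V} (ha : G.Adj v a) (hb : G.Adj v b) (hc : G.Adj v c)
    (hd : G.Adj v d) (hab : G.CoAdj a b) (hcd : G.CoAdj c d) (hac : G.Adj a c) (had : G.Adj a d)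
    (hbc : G.Adj b c) (hbd : G.Adj b d) : False :=
  false_of_wheel_four hG.wheel_four ha hc hb hd hac hbc.symm hbd had.symm hab hcd

theorem exists_isLocalColoring (v : V) : ∃ t, G.IsLocalColoring v t := by
  classical
  by_cases h : ∃ a b, G.Adj v a ∧ G.Adj v b ∧ G.CoAdj a b
  · obtain ⟨a, b, ha, hb, hab⟩ := h
    refine ⟨fun u => decide (∃ w, G.Adj v w ∧ G.CoAdj w u ∧ G.CoAdj w a), ?_⟩
    intro u u' hu hu' huu'
    have htri : ∀ x y z, G.Adj v x → G.Adj v y → G.Adj v z → G.CoAdj x y → G.CoAdj y z →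
      G.CoAdj x z → False := fun x y z => hG.no_coTriangle
    have hadj : ∀ x y, G.Adj x y ∨ x = y ∨ G.CoAdj x y := by
      intro x y; unfold CoAdj; tauto
    have hsymm : ∀ x y, G.CoAdj x y → G.CoAdj y x := fun x y => CoAdj.symm
    have hsymm' : ∀ x y, G.Adj x y → G.Adj y x := fun x y h => h.symm
    simp only [ne_eq, decide_eq_decide]
    have hone : (∃ w, G.Adj v w ∧ G.CoAdj w u ∧ G.CoAdj w a) ∨
        (∃ w, G.Adj v w ∧ G.CoAdj w u' ∧ G.CoAdj w a) := by
      have := @no_square _ _ hG v a b u u' ha hb hu hu' hab huu'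
      rcases hadj a u with h1 | h1 | h1
      · rcases hadj a u' with h2 | h2 | h2
        · rcases hadj b u with h3 | h3 | h3
          · rcases hadj b u' with h4 | h4 | h4
            · exact (this h1 h2 h3 h4).elim
            · subst h4; exact .inl ⟨b, hb, huu'.symm, hab.symm⟩
            · exact .inr ⟨b, hb, h4, hab.symm⟩
          · subst h3; exact .inr ⟨b, hb, huu', hab.symm⟩
          · exact .inl ⟨b, hb, h3, hab.symm⟩
        · subst h2; exact .inr ⟨b, hb, hab.symm, hab.symm⟩
        · exact .inl ⟨u', hu', huu'.symm, h2.symm⟩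
      · subst h1; exact .inl ⟨b, hb, hab.symm, hab.symm⟩
      · exact .inr ⟨u, hu, huu', h1.symm⟩
    have htwo : ¬ ((∃ w, G.Adj v w ∧ G.CoAdj w u ∧ G.CoAdj w a) ∧
        (∃ w, G.Adj v w ∧ G.CoAdj w u' ∧ G.CoAdj w a)) := by
      rintro ⟨⟨w, hw, hwu, hwa⟩, w', hw', hwu', hwa'⟩
      rcases hadj a u with h1 | h1 | h1
      · rcases hadj a u' with h2 | h2 | h2
        · rcases hadj w u' with h3 | h3 | h3
          · rcases hadj w' u with h4 | h4 | h4
            · rcases hadj w w' with h5 | h5 | h5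
              · exact false_of_wheel_five hG.wheel_five ha hu hw' hw hu'
                  h1 h4.symm h5.symm h3 h2.symm hwa'.symm hwu.symm hwu' hwa huu'.symm
              · subst h5; exact htri _ _ _ hw hu hu' hwu huu' hwu'
              · exact htri _ _ _ hw hw' ha h5 hwa' hwa
            · subst h4; exact (hwa'.symm.2 h1).elim
            · exact htri _ _ _ hw' hu hu' h4 huu' hwu'
          · subst h3; exact hwa.symm.2 h2
          · exact htri _ _ _ hw hu hu' hwu huu' h3
        · subst h2; exact htri _ _ _ hw hu ha hwu huu' hwa
        · exact htri _ _ _ hw' hu' ha hwu' h2.symm hwa'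
      · subst h1; exact htri _ _ _ hw' hu' ha hwu' huu'.symm hwa'
      · exact htri _ _ _ hw hu ha hwu h1.symm hwa
    intro h
    rcases hone with p | q
    · exact htwo ⟨p, h.1 p⟩
    · exact htwo ⟨h.2 q, q⟩
  · exact ⟨fun _ => true, fun a b ha hb hab => (h ⟨a, b, ha, hb, hab⟩).elim⟩

theorem coloring_agree {v c d : V} {t t' : V → Bool} (ht : G.IsLocalColoring v t)
    (ht' : G.IsLocalColoring v t') (hc : G.Split v c) (hd : G.Split v d) (h : t c = t' c) :
    t d = t' d := by
  obtain ⟨hc, c', hc', hcc⟩ := hc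
  obtain ⟨hd, d', hd', hdd⟩ := hd
  have key : ∀ x y, G.Adj v x → G.Adj v y → G.CoAdj x y → (t x = t' x ↔ t y = t' y) := by
    intro x y hx hy hxy
    have h1 := ht x y hx hy hxy
    have h2 := ht' x y hx hy hxy
    revert h1 h2
    generalize t x = a, t y = b, t' x = c, t' y = d
    revert a b c d
    decide
  have hadj : ∀ x y, G.Adj x y ∨ x = y ∨ G.CoAdj x y := by
    intro x y; unfold CoAdj; tauto
  have := @no_square _ _ hG v c c' d d' hc hc' hd hd' hcc hdd
  have h1 := key _ _ hc hc' hcc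
  have h2 := key _ _ hd hd' hdd
  rcases hadj c d with h3 | h3 | h3
  · rcases hadj c d' with h4 | h4 | h4
    · rcases hadj c' d with h5 | h5 | h5
      · rcases hadj c' d' with h6 | h6 | h6
        · exact (this h3 h4 h5 h6).elim
        · grind
        · have := key _ _ hc' hd' h6; grind
      · grind
      · have := key _ _ hc' hd h5; grind
    · grind
    · have := key _ _ hc hd' h4; grind
  · grind
  · have := key _ _ hc hd h3; grind

end ForbiddenFree
end SimpleGraph

namespace SimpleGraph
variable {V : Type*} {G : SimpleGraph V}

theorem adj_or_eq_or_coAdj (a b : V) : G.Adj a b ∨ a = b ∨ G.CoAdj a b := by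
  unfold CoAdj; tauto

theorem Split.or {u v w : V} (huv : G.Adj u v) (hvw : G.Adj v w) (h : G.Split u w) :
    G.Split u v ∨ G.Split v w := by
  by_contra! h'
  obtain ⟨-, d, hd, hwd⟩ := h
  exact h'.2 ⟨hvw, d, adj_of_not_split huv h'.1 hd fun e => hwd.2 (e ▸ hvw.symm), hwd⟩

theorem IsLocalColoring.not {v : V} {t : V → Bool} (ht : G.IsLocalColoring v t) :
    G.IsLocalColoring v (fun a => !(t a)) := by
  intro a b ha hb hab
  have := ht a b ha hb hab
  simpa using this

theorem IsLocalColoring.adj {v a b : V} {t : V → Bool} (ht : G.IsLocalColoring v t)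
    (ha : G.Adj v a) (hb : G.Adj v b) (hab : a ≠ b) (h : t a = t b) : G.Adj a b := by
  by_contra h'
  exact ht a b ha hb ⟨hab, h'⟩ h

/-- The local colourings `o` at `u` and `o'` at `v` orient the edge `uv` consistently. -/
def Aligned (G : SimpleGraph V) (u v : V) (o o' : V → Bool) : Prop :=
  (G.Split u v → G.Split v u → o v ≠ o' u) ∧
    (¬ (G.Split u v ∧ G.Split v u) → ∀ c, G.Split u c → G.Split v c → o c = o' c)

theorem Aligned.symm {u v : V} {o o' : V → Bool} (h : G.Aligned u v o o') :
    G.Aligned v u o' o :=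
  ⟨fun h1 h2 => (h.1 h2 h1).symm, fun h1 c h2 h3 => (h.2 (fun h => h1 h.symm) c h3 h2).symm⟩

theorem Aligned.not {u v : V} {o o' : V → Bool} (h : G.Aligned u v o o') :
    G.Aligned u v (fun a => !(o a)) (fun a => !(o' a)) := by
  refine ⟨fun h1 h2 => ?_, fun h1 c h2 h3 => ?_⟩
  · simpa using h.1 h1 h2
  · simpa using h.2 h1 c h2 h3

theorem Aligned.eq_of_not_split {u v c : V} {o o' : V → Bool} (h : G.Aligned u v o o')
    (huv : G.Adj u v) (hs : ¬ G.Split u v) (hc : G.Split u c) : o c = o' c :=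
  h.2 (fun h' => hs h'.1) c hc (Split.of_not_split huv hs hc)

namespace ForbiddenFree

variable (hG : G.ForbiddenFree)
include hG

theorem aligned_of_eq {u v c : V} {o o' : V → Bool} (ho : G.IsLocalColoring u o)
    (ho' : G.IsLocalColoring v o') (huv : G.Adj u v) (hs : ¬ G.Split u v) (hc : G.Split u c)
    (h : o c = o' c) : G.Aligned u v o o' :=
  ⟨fun h1 _ => (hs h1).elim, fun _ _ hd _ =>
    hG.coloring_agree ho (ho'.of_not_split huv hs) hc hd h⟩

theorem aligned_or_aligned_not {u v : V} {o o' : V → Bool} (ho : G.IsLocalColoring u o)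
    (ho' : G.IsLocalColoring v o') (huv : G.Adj u v) (hu : ∃ c, G.Split u c)
    (hv : ∃ c, G.Split v c) :
    G.Aligned u v o o' ∨ G.Aligned u v o (fun a => !(o' a)) := by
  by_cases h1 : G.Split u v
  · by_cases h2 : G.Split v u
    · by_cases h : o v = o' u
      · exact .inr ⟨by simp [h], fun h' => (h' ⟨h1, h2⟩).elim⟩
      · exact .inl ⟨fun _ _ => h, fun h' => (h' ⟨h1, h2⟩).elim⟩
    · obtain ⟨c, hc⟩ := hv
      by_cases h : o c = o' c
      · exact .inl (hG.aligned_of_eq ho' ho huv.symm h2 hc h.symm).symm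
      · exact .inr (hG.aligned_of_eq ho'.not ho huv.symm h2 hc
          (by cases h : o c <;> simp_all)).symm
  · obtain ⟨c, hc⟩ := hu
    by_cases h : o c = o' c
    · exact .inl (hG.aligned_of_eq ho ho' huv h1 hc h)
    · exact .inr (hG.aligned_of_eq ho ho'.not huv h1 hc (by cases h : o c <;> simp_all))

omit hG in
theorem _root_.SimpleGraph.Aligned.not_aligned_not {u v : V} {o o' : V → Bool} (huv : G.Adj u v)
    (hu : ∃ c, G.Split u c) (hv : ∃ c, G.Split v c) (h : G.Aligned u v o o') :
    ¬ G.Aligned u v o (fun a => !(o' a)) := by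
  intro h'
  by_cases h1 : G.Split u v
  · by_cases h2 : G.Split v u
    · have := h.1 h1 h2
      have := h'.1 h1 h2
      simp_all
    · obtain ⟨c, hc⟩ := hv
      have := h.symm.eq_of_not_split huv.symm h2 hc
      have := h'.symm.eq_of_not_split huv.symm h2 hc
      simp_all
  · obtain ⟨c, hc⟩ := hu
    have := h.eq_of_not_split huv h1 hc
    have := h'.eq_of_not_split huv h1 hc
    simp_all

section Triangle

variable {u v w : V} {o o₁ o₂ : V → Bool} (huv : G.Adj u v) (huw : G.Adj u w) (hvw : G.Adj v w)
include huv huw hvw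

theorem aligned_of_below_both (hu : ∃ c, G.Split u c)
    (ho₁ : G.IsLocalColoring v o₁) (ho₂ : G.IsLocalColoring w o₂)
    (h₁ : ¬ G.Split u v) (h₂ : ¬ G.Split u w)
    (ha₁ : G.Aligned u v o o₁) (ha₂ : G.Aligned u w o o₂) : G.Aligned v w o₁ o₂ := by
  obtain ⟨c₀, hc₀⟩ := hu
  have e : o₁ c₀ = o₂ c₀ :=
    (ha₁.eq_of_not_split huv h₁ hc₀).symm.trans (ha₂.eq_of_not_split huw h₂ hc₀)
  by_cases hs₁ : G.Split v w
  swap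
  · exact hG.aligned_of_eq ho₁ ho₂ hvw hs₁ (Split.of_not_split huv h₁ hc₀) e
  by_cases hs₂ : G.Split w v
  swap
  · exact (hG.aligned_of_eq ho₂ ho₁ hvw.symm hs₂ (Split.of_not_split huw h₂ hc₀) e.symm).symm
  refine ⟨fun _ _ => ?_, fun h => (h ⟨hs₁, hs₂⟩).elim⟩
  obtain ⟨huc, d₀, hud, hcd⟩ := hc₀
  obtain ⟨-, x, hvx, hwx⟩ := hs₁
  obtain ⟨-, y, hwy, hvy⟩ := hs₂
  have hux : G.CoAdj u x := ⟨fun h => hwx.2 (h ▸ huw.symm), fun h =>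
    hwx.2 (adj_of_not_split huw h₂ h hwx.1.symm)⟩
  have huy : G.CoAdj u y := ⟨fun h => hvy.2 (h ▸ huv.symm), fun h =>
    hvy.2 (adj_of_not_split huv h₁ h hvy.1.symm)⟩
  have main : ∀ c d, G.Adj u c → G.Adj u d → G.CoAdj c d → o₁ c = o₂ c → G.CoAdj x c →
      o₁ w ≠ o₂ v := by
    intro c d huc hud hcd e hxc
    have hs : G.Split u c := ⟨huc, d, hud, hcd⟩
    have hs' : G.Split u d := ⟨hud, c, huc, hcd.symm⟩
    have hvc := (Split.of_not_split huv h₁ hs).1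
    have hwc := (Split.of_not_split huw h₂ hs).1
    have hvd := (Split.of_not_split huv h₁ hs').1
    have hwd := (Split.of_not_split huw h₂ hs').1
    have e1 := ho₁ _ _ hvx hvc hxc
    have e2 := ho₁ _ _ hvx hvw hwx.symm
    have e3 : o₂ y ≠ o₂ v := ho₂ _ _ hwy hvw.symm hvy.symm
    have e4 := ho₂ _ _ hwc hwd hcd
    rcases adj_or_eq_or_coAdj (G := G) y d with h | h | h
    · rcases adj_or_eq_or_coAdj (G := G) x d with h' | h' | h'
      · rcases adj_or_eq_or_coAdj (G := G) x y with h'' | h'' | h''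
        · exact (false_of_wheel_four hG.wheel_four h'.symm hvd.symm hwd.symm h.symm hvx.symm hvw
            hwy h''.symm hwx.symm hvy).elim
        · exact (hvy.2 (h'' ▸ hvx)).elim
        · exact (hG.no_coTriangle h'.symm h.symm hud.symm h'' huy.symm hux.symm).elim
      · exact (hwx.2 (h' ▸ hwd)).elim
      · exact (hG.no_coTriangle hvx hvc hvd hxc hcd h').elim
    · exact (hvy.2 (h ▸ hvd)).elim
    · have e5 := ho₂ _ _ hwy hwd h
      revert e e1 e2 e3 e4 e5
      generalize o₁ x = b1, o₁ c = b2, o₁ w = b3, o₂ y = b4, o₂ v = b5, o₂ c = b6, o₂ d = b7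
      revert b1 b2 b3 b4 b5 b6 b7
      decide
  have e' : o₁ d₀ = o₂ d₀ := by
    have hs' : G.Split u d₀ := ⟨hud, c₀, huc, hcd.symm⟩
    exact (ha₁.eq_of_not_split huv h₁ hs').symm.trans (ha₂.eq_of_not_split huw h₂ hs')
  have hvc := (Split.of_not_split huv h₁ ⟨huc, d₀, hud, hcd⟩).1
  have hvd := (Split.of_not_split huv h₁ ⟨hud, c₀, huc, hcd.symm⟩).1
  have hwc := (Split.of_not_split huw h₂ ⟨huc, d₀, hud, hcd⟩).1
  have hwd := (Split.of_not_split huw h₂ ⟨hud, c₀, huc, hcd.symm⟩).1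
  rcases adj_or_eq_or_coAdj (G := G) x c₀ with h | h | h
  · rcases adj_or_eq_or_coAdj (G := G) x d₀ with h' | h' | h'
    · exact (hG.no_square hvc hvd huv.symm hvx hcd hux huc.symm h.symm hud.symm h'.symm).elim
    · exact (hwx.2 (h' ▸ hwd)).elim
    · exact main _ _ hud huc hcd.symm e' h'
  · exact (hwx.2 (h ▸ hwc)).elim
  · exact main _ _ huc hud hcd e h

theorem aligned_of_above_both (ho₀ : G.IsLocalColoring v o₁)
    (h₁ : ¬ G.Split u v) (h₂ : ¬ G.Split w v) (h₃ : G.Split u w) (h₄ : G.Split w u)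
    (ha₁ : G.Aligned u v o o₁) (ha₂ : G.Aligned w v o₂ o₁) : G.Aligned u w o o₂ := by
  refine ⟨fun _ _ => ?_, fun h => (h ⟨h₃, h₄⟩).elim⟩
  rw [ha₁.eq_of_not_split huv h₁ h₃, ha₂.eq_of_not_split hvw.symm h₂ h₄]
  obtain ⟨-, x, hux, hwx⟩ := h₃
  obtain ⟨-, y, hwy, huy⟩ := h₄
  have hvx : G.Adj v x := adj_of_not_split huv h₁ hux (fun h => hwx.2 (h ▸ hvw.symm))
  have hvy : G.Adj v y := adj_of_not_split hvw.symm h₂ hwy (fun h => huy.2 (h ▸ huv))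
  rcases adj_or_eq_or_coAdj (G := G) x y with h | h | h
  · exact (hG.no_square huv.symm hvy hvw hvx huy hwx huw hux hwy.symm h.symm).elim
  · exact (huy.2 (h ▸ hux)).elim
  · have e1 := ho₀ _ _ hvx hvy h
    have e2 := ho₀ _ _ hvw hvx hwx
    have e3 := ho₀ _ _ huv.symm hvy huy
    revert e1 e2 e3
    generalize o₁ x = b1, o₁ y = b2, o₁ w = b3, o₁ u = b4
    revert b1 b2 b3 b4
    decide

omit hG in
theorem _root_.SimpleGraph.Aligned.of_below_one (ho₂ : G.IsLocalColoring w o₂)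
    (h₁ : ¬ G.Split u v) (h₂ : G.Split u w) (h₃ : G.Split w u) (h₄ : G.Split v w)
    (h₅ : G.Split w v) (ha₁ : G.Aligned u v o o₁) (ha₂ : G.Aligned u w o o₂) :
    G.Aligned v w o₁ o₂ := by
  refine ⟨fun _ _ => ?_, fun h => (h ⟨h₄, h₅⟩).elim⟩
  have e1 := ha₁.eq_of_not_split huv h₁ h₂
  have e2 := ha₂.1 h₂ h₃
  obtain ⟨-, y, hwy, hvy⟩ := h₅
  have huy : G.CoAdj u y := ⟨fun h => hvy.2 (h ▸ huv.symm), fun h =>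
    hvy.2 (adj_of_not_split huv h₁ h hvy.1.symm)⟩
  have e3 := ho₂ _ _ hvw.symm hwy hvy
  have e4 := ho₂ _ _ huw.symm hwy huy
  revert e1 e2 e3 e4
  generalize o w = b1, o₁ w = b2, o₂ u = b3, o₂ v = b4, o₂ y = b5
  revert b1 b2 b3 b4 b5
  decide

theorem exists_private (ho : G.IsLocalColoring u o) (h : o v = o w)
    (h₁ : G.Split u v) (h₂ : G.Split u w) : ∃ x, G.Adj u x ∧ G.CoAdj v x ∧ G.CoAdj w x := by
  obtain ⟨-, x, hux, hvx⟩ := h₁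
  obtain ⟨-, y, huy, hwy⟩ := h₂
  rcases adj_or_eq_or_coAdj (G := G) w x with h1 | h1 | h1
  · rcases adj_or_eq_or_coAdj (G := G) v y with h2 | h2 | h2
    · have hxy : G.Adj x y := ho.adj hux huy (fun h => hvx.2 (h ▸ h2)) (by
        have e1 := ho _ _ huv hux hvx
        have e2 := ho _ _ huw huy hwy
        revert e1 e2 h
        generalize o x = b1, o y = b2, o w = b3, o v = b4
        revert b1 b2 b3 b4
        decide)
      exact (hG.no_square huv hux huw huy hvx hwy hvw h2 h1.symm hxy).elim
    · exact (hwy.2 (h2 ▸ hvw.symm)).elim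
    · exact ⟨y, huy, h2, hwy⟩
  · exact (hvx.2 (h1 ▸ hvw)).elim
  · exact ⟨x, hux, hvx, h1⟩

theorem not_two_middle (ho : G.IsLocalColoring u o) (ho₁ : G.IsLocalColoring v o₁)
    (ho₂ : G.IsLocalColoring w o₂) (h₁ : G.Split v w) (h₂ : G.Split w v)
    (hu : o v = o w) (hv : o₁ u ≠ o₁ w) (hw : o₂ u ≠ o₂ v) : False := by
  obtain ⟨-, p, hvp, hwp⟩ := h₁
  obtain ⟨-, q, hwq, hvq⟩ := h₂
  have hup : G.Adj p u := ho₁.adj hvp huv.symm (fun h => hwp.2 (h ▸ huw.symm)) (by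
    have e1 := ho₁ _ _ hvw hvp hwp
    revert e1 hv
    generalize o₁ p = b1, o₁ w = b2, o₁ u = b3
    revert b1 b2 b3
    decide)
  have huq : G.Adj q u := ho₂.adj hwq huw.symm (fun h => hvq.2 (h ▸ huv.symm)) (by
    have e1 := ho₂ _ _ hvw.symm hwq hvq
    revert e1 hw
    generalize o₂ q = b1, o₂ v = b2, o₂ u = b3
    revert b1 b2 b3
    decide)
  have hpq : G.Adj p q := ho.adj hup.symm huq.symm (fun h => hvq.2 (h ▸ hvp)) (by
    have e1 := ho _ _ huv huq.symm hvq
    have e2 := ho _ _ huw hup.symm hwp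
    revert e1 e2 hu
    generalize o q = b1, o p = b2, o w = b3, o v = b4
    revert b1 b2 b3 b4
    decide)
  exact false_of_wheel_four hG.wheel_four hup.symm huq.symm huw huv hpq hwq.symm hvw.symm hvp
    hwp.symm hvq.symm

theorem not_three_private {x y z : V} (hux : G.Adj u x) (hvx : G.CoAdj v x) (hwx : G.CoAdj w x)
    (hvy : G.Adj v y) (huy : G.CoAdj u y) (hwy : G.CoAdj w y)
    (hwz : G.Adj w z) (huz : G.CoAdj u z) (hvz : G.CoAdj v z) : False := by
  have hxy' : x ≠ y := fun h => hvx.2 (h ▸ hvy)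
  have hxz' : x ≠ z := fun h => hwx.2 (h ▸ hwz)
  have hyz' : y ≠ z := fun h => hwy.2 (h ▸ hwz)
  by_cases hxy : G.Adj x y <;> by_cases hxz : G.Adj x z <;> by_cases hyz : G.Adj y z
  · exact false_of_prism hG.prism huv huw hvw hxy hxz hyz hux hvy hwz huy huz hvx hvz hwx hwy
  · exact hG.no_coTriangle hux.symm hxy hxz huy ⟨hyz', hyz⟩ huz
  · exact hG.no_coTriangle hvy.symm hxy.symm hyz hvx ⟨hxz', hxz⟩ hvz
  · exact false_of_cycleStar_four (hG.cycleStar 4 le_rfl) huz.symm hvz.symm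
      ⟨hyz'.symm, fun h => hyz h.symm⟩ ⟨hxz'.symm, fun h => hxz h.symm⟩ huv hvy hxy.symm hux.symm
      huy hvx
  · exact hG.no_coTriangle hwz.symm hxz.symm hyz.symm hwx ⟨hxy', hxy⟩ hwy
  · exact false_of_cycleStar_four (hG.cycleStar 4 le_rfl) huy.symm hwy.symm
      ⟨hyz', hyz⟩ ⟨hxy'.symm, fun h => hxy h.symm⟩ huw hwz hxz.symm hux.symm
      huz hwx
  · exact false_of_cycleStar_four (hG.cycleStar 4 le_rfl) hvx.symm hwx.symm
      ⟨hxz', hxz⟩ ⟨hxy', hxy⟩ hvw hwz hyz.symm hvy.symm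
      hvz hwy
  · exact false_of_net hG.net huv huw hvw hux hvy hwz huy huz hvx hvz hwx hwy
      ⟨hxy', hxy⟩ ⟨hxz', hxz⟩ ⟨hyz', hyz⟩

theorem aligned_of_all_split (ho : G.IsLocalColoring u o)
    (ho₁ : G.IsLocalColoring v o₁) (ho₂ : G.IsLocalColoring w o₂)
    (h₁ : G.Split u v) (h₂ : G.Split v u) (h₃ : G.Split u w) (h₄ : G.Split w u)
    (h₅ : G.Split v w) (h₆ : G.Split w v)
    (ha₁ : G.Aligned u v o o₁) (ha₂ : G.Aligned u w o o₂) : G.Aligned v w o₁ o₂ := by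
  refine ⟨fun _ _ => ?_, fun h => (h ⟨h₅, h₆⟩).elim⟩
  have e1 := ha₁.1 h₁ h₂
  have e2 := ha₂.1 h₃ h₄
  have k1 := hG.not_two_middle huv huw hvw ho ho₁ ho₂ h₅ h₆
  have k2 := hG.not_two_middle huv.symm hvw huw ho₁ ho ho₂ h₃ h₄
  have k3 := hG.not_two_middle huw.symm hvw.symm huv ho₂ ho ho₁ h₁ h₂
  have k4 : ¬ (o v = o w ∧ o₁ u = o₁ w ∧ o₂ u = o₂ v) := by
    rintro ⟨a, b, c⟩
    obtain ⟨x, hux, hvx, hwx⟩ := hG.exists_private huv huw hvw ho a h₁ h₃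
    obtain ⟨y, hvy, huy, hwy⟩ := hG.exists_private huv.symm hvw huw ho₁ b h₂ h₅
    obtain ⟨z, hwz, huz, hvz⟩ := hG.exists_private huw.symm hvw.symm huv ho₂ c h₄ h₆
    exact hG.not_three_private huv huw hvw hux hvx hwx hvy huy hwy hwz huz hvz
  revert e1 e2 k1 k2 k3 k4
  generalize o v = b1, o w = b2, o₁ u = b3, o₁ w = b4, o₂ u = b5, o₂ v = b6
  cases b1 <;> cases b2 <;> cases b3 <;> cases b4 <;> cases b5 <;> cases b6 <;> simp

end Triangle

end ForbiddenFree

/-- Consistency of the edges `uv` and `uw` forces consistency of `vw`. -/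
def AlignedTrans (G : SimpleGraph V) (u v w : V) : Prop :=
  ∀ o o₁ o₂, G.IsLocalColoring u o → G.IsLocalColoring v o₁ → G.IsLocalColoring w o₂ →
    G.Aligned u v o o₁ → G.Aligned u w o o₂ → G.Aligned v w o₁ o₂

theorem AlignedTrans.swap {u v w : V} (h : G.AlignedTrans u v w) : G.AlignedTrans u w v :=
  fun o o₁ o₂ ho ho₁ ho₂ h₁ h₂ => (h o o₂ o₁ ho ho₂ ho₁ h₂ h₁).symm

theorem ForbiddenFree.alignedTrans_rotate (hG : G.ForbiddenFree) {u v w : V} (huw : G.Adj u w)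
    (hvw : G.Adj v w) (hu : ∃ c, G.Split u c) (hv : ∃ c, G.Split v c) (hw : ∃ c, G.Split w c)
    (h : G.AlignedTrans u v w) : G.AlignedTrans v u w := by
  intro o o₁ o₂ ho ho₁ ho₂ h₁ h₂
  rcases hG.aligned_or_aligned_not ho₁ ho₂ huw hu hw with h₃ | h₃
  · exact h₃
  · exact (h₂.not_aligned_not hvw hv hw (h _ _ _ ho₁ ho ho₂.not h₁.symm h₃)).elim

theorem ForbiddenFree.alignedTrans (hG : G.ForbiddenFree) {u v w : V} (huv : G.Adj u v)
    (huw : G.Adj u w) (hvw : G.Adj v w)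
    (hu : ∃ c, G.Split u c) (hv : ∃ c, G.Split v c) (hw : ∃ c, G.Split w c) :
    G.AlignedTrans u v w := by
  have rot₁ : G.AlignedTrans v u w → G.AlignedTrans u v w :=
    hG.alignedTrans_rotate hvw huw hv hu hw
  have rot₂ : G.AlignedTrans w u v → G.AlignedTrans u v w := fun h =>
    (hG.alignedTrans_rotate hvw.symm huv hw hu hv h).swap
  have below : ∀ {u v w : V}, G.Adj u v → G.Adj u w → G.Adj v w → (∃ c, G.Split u c) →
      ¬ G.Split u v → ¬ G.Split u w → G.AlignedTrans u v w := fun huv huw hvw hu h₁ h₂ _ _ _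
    _ ho₁ ho₂ ha₁ ha₂ => hG.aligned_of_below_both huv huw hvw hu ho₁ ho₂ h₁ h₂ ha₁ ha₂
  have above : ∀ {u v w : V}, G.Adj u v → G.Adj u w → G.Adj v w → ¬ G.Split u v → ¬ G.Split w v →
      G.Split u w → G.Split w u → G.AlignedTrans v u w := fun huv huw hvw h₁ h₂ h₃ h₄ _ _ _
    ho _ _ ha₁ ha₂ => hG.aligned_of_above_both huv huw hvw ho h₁ h₂ h₃ h₄ ha₁.symm ha₂.symm
  have one : ∀ {u v w : V}, G.Adj u v → G.Adj u w → G.Adj v w → ¬ G.Split u v →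
      G.Split u w → G.Split w u → G.Split v w → G.Split w v → G.AlignedTrans u v w :=
    fun huv huw hvw h₁ h₂ h₃ h₄ h₅ _ _ _ _ _ ho₂ ha₁ ha₂ =>
      ha₁.of_below_one huv huw hvw ho₂ h₁ h₂ h₃ h₄ h₅ ha₂
  have t₁ := Split.or (G := G) huv hvw
  have t₂ := Split.or (G := G) huw hvw.symm
  have t₃ := Split.or (G := G) huv.symm huw
  have t₄ := Split.or (G := G) hvw huw.symm
  have t₅ := Split.or (G := G) huw.symm huv
  have t₆ := Split.or (G := G) hvw.symm huv.symm
  by_cases h₁ : G.Split u v <;> by_cases h₂ : G.Split v u <;> by_cases h₃ : G.Split u w <;>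
    by_cases h₄ : G.Split w u <;> by_cases h₅ : G.Split v w <;> by_cases h₆ : G.Split w v <;>
    first
    | exact below huv huw hvw hu h₁ h₃
    | exact rot₁ (below huv.symm hvw huw hv h₂ h₅)
    | exact rot₂ (below huw.symm hvw.symm huv hw h₄ h₆)
    | exact rot₁ (above huv huw hvw h₁ h₆ h₃ h₄)
    | exact rot₂ (above huw huv hvw.symm h₃ h₅ h₁ h₂)
    | exact above huv.symm hvw huw h₂ h₄ h₅ h₆
    | exact one huv huw hvw h₁ h₃ h₄ h₅ h₆
    | exact (one huw huv hvw.symm h₃ h₁ h₂ h₆ h₅).swap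
    | exact rot₁ (one huv.symm hvw huw h₂ h₅ h₆ h₃ h₄)
    | exact rot₁ (one hvw huv.symm huw.symm h₅ h₂ h₁ h₄ h₃).swap
    | exact rot₂ (one huw.symm hvw.symm huv h₄ h₆ h₅ h₁ h₂)
    | exact rot₂ (one hvw.symm huw.symm huv.symm h₆ h₄ h₃ h₂ h₁).swap
    | exact fun _ _ _ ho ho₁ ho₂ => hG.aligned_of_all_split huv huw hvw ho ho₁ ho₂
        h₁ h₂ h₃ h₄ h₅ h₆
    | exact (by simp_all : False).elim

end SimpleGraph

namespace SimpleGraph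
variable {V : Type*} {G : SimpleGraph V}

namespace Walk

/-- The sum modulo two of the labels `σ` along a walk. -/
def parity (σ : V → V → Bool) : ∀ {u v : V}, G.Walk u v → Bool
  | _, _, nil => false
  | u, _, cons (v := w) _ p => xor (σ u w) (p.parity σ)

variable {σ : V → V → Bool}

theorem parity_append {u v w : V} (p : G.Walk u v) (q : G.Walk v w) :
    (p.append q).parity σ = xor (p.parity σ) (q.parity σ) := by
  induction p with
  | nil => simp [parity]
  | cons h p ih => simp [parity, ih]

theorem parity_reverse (hσ : ∀ u v, σ u v = σ v u) {u v : V} (p : G.Walk u v) :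
    p.reverse.parity σ = p.parity σ := by
  induction p with
  | nil => simp [parity]
  | @cons a b c h p ih =>
    simp [parity, parity_append, ih, hσ b a, Bool.xor_comm]

theorem parity_eq_of_potential {u v : V} (p : G.Walk u v) (f : ℕ → Bool)
    (h : ∀ i < p.length, σ (p.getVert i) (p.getVert (i + 1)) = xor (f i) (f (i + 1))) :
    p.parity σ = xor (f 0) (f p.length) := by
  induction p generalizing f with
  | nil => simp [parity]
  | @cons a b c hab p ih =>
    have h0 := h 0 (by simp)
    have h1 := ih (fun i => f (i + 1)) (fun i hi => by
      have := h (i + 1) (by simpa using hi)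
      simpa using this)
    simp only [getVert_zero, getVert_cons_succ, zero_add] at h0
    simp [parity, h0, h1, ← Bool.xor_assoc]

theorem exists_split {u v : V} (p : G.Walk u v) {i : ℕ} (hi : i ≤ p.length) :
    ∃ (p₁ : G.Walk u (p.getVert i)) (p₂ : G.Walk (p.getVert i) v), p₁.length = i ∧
      p₂.length + i = p.length ∧ p.parity σ = xor (p₁.parity σ) (p₂.parity σ) ∧
      ∀ k, i + k ≤ p.length → p₂.getVert k = p.getVert (i + k) := by
  refine ⟨p.take i, p.drop i, ?_, ?_, ?_, ?_⟩
  · simp [hi]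
  · simp [hi]
  · rw [← parity_append, append_take_drop_eq]
  · intro k hk; simp

theorem exists_split_two {u v : V} (p : G.Walk u v) {i j : ℕ} (hij : i ≤ j) (hj : j ≤ p.length) :
    ∃ (p₁ : G.Walk u (p.getVert i)) (p₂ : G.Walk (p.getVert i) (p.getVert j))
      (p₃ : G.Walk (p.getVert j) v), p₁.length = i ∧ p₂.length + i = j ∧
      p₃.length + j = p.length ∧
      p.parity σ = xor (p₁.parity σ) (xor (p₂.parity σ) (p₃.parity σ)) := by
  obtain ⟨p₁, q, h1, h2, h3, h4⟩ := p.exists_split (σ := σ) (hij.trans hj)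
  have h5 := h4 (j - i) (by omega)
  rw [Nat.add_sub_cancel' hij] at h5
  obtain ⟨p₂, p₃, k1, k2, k3, -⟩ := q.exists_split (σ := σ) (i := j - i) (by omega)
  rw [← h5]
  exact ⟨p₁, p₂, p₃, h1, by omega, by omega, by rw [h3, k3]⟩

end Walk

variable {σ : V → V → Bool}

theorem parity_closed_walk_eq_false (hσ : ∀ u v, σ u v = σ v u)
    (htri : ∀ u v w, G.Adj u v → G.Adj v w → G.Adj u w → xor (σ u v) (σ v w) = σ u w)
    (hhole : ∀ n g, 4 ≤ n → G.IsInducedCycle n g → g n = g 0 →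
      ∃ f : ℕ → Bool, f n = f 0 ∧ ∀ i < n, σ (g i) (g (i + 1)) = xor (f i) (f (i + 1)))
    (n : ℕ) : ∀ {u : V} (p : G.Walk u u), p.length = n → p.parity σ = false := by
  induction n using Nat.strong_induction_on with
  | _ n ih =>
  intro u p hp
  by_contra hodd
  have shortcut : ∀ i j (q : G.Walk (p.getVert i) (p.getVert j)), i < j → j < n →
      q.length + (j - i) < n → q.length < j - i → False := by
    intro i j q hij hj h1 h2
    obtain ⟨p₁, p₂, p₃, l1, l2, l3, e⟩ := p.exists_split_two (σ := σ) hij.le (hp ▸ hj.le)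
    have k1 := ih _ (by simp; omega) (p₂.append q.reverse) rfl
    have k2 := ih _ (by simp; omega) (p₁.append (q.append p₃)) rfl
    simp only [Walk.parity_append, Walk.parity_reverse hσ] at k1 k2
    rw [e] at hodd
    revert k1 k2 hodd
    cases p₁.parity σ <;> cases p₂.parity σ <;> cases p₃.parity σ <;> cases q.parity σ <;> simp
  have hadj : ∀ i < n, G.Adj (p.getVert i) (p.getVert (i + 1)) := fun i hi =>
    p.adj_getVert_succ (hp ▸ hi)
  have hlast : p.getVert n = p.getVert 0 := by simp [← hp]
  have hcyc : G.IsInducedCycle n p.getVert := by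
    intro i j hij hj
    refine ⟨fun h => shortcut i j (Walk.nil.copy rfl h) hij hj (by simp; omega) (by simp; omega),
      fun h => ?_, ?_⟩
    · by_contra! h'
      exact shortcut i j h.toWalk hij hj (by simp; omega) (by simp; omega)
    · rintro (rfl | ⟨rfl, rfl⟩)
      · exact hadj _ (by omega)
      · rw [← hlast]; exact (hadj j hj).symm
  rcases Nat.lt_or_ge n 4 with hn | hn
  · apply hodd
    match p, hp with
    | .nil, _ => rfl
    | .cons h .nil, _ => exact (h.ne rfl).elim
    | .cons (v := v) h (.cons h' .nil), _ => simp [Walk.parity, hσ v u]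
    | .cons (v := v) h (.cons (v := w) h' (.cons h'' .nil)), _ =>
      have := htri _ _ _ h h' h''.symm
      simp [Walk.parity, ← Bool.xor_assoc, this, hσ w u]
    | .cons h (.cons h' (.cons h'' (.cons h''' q))), hp => simp at hp; omega
  · obtain ⟨f, hf, hf'⟩ := hhole n p.getVert hn hcyc hlast
    apply hodd
    rw [p.parity_eq_of_potential f (fun i hi => hf' i (hp ▸ hi)), hp, hf]
    simp

/-- A labelling of the edges that sums to zero along triangles and holes has a potential. -/
theorem exists_potential (hσ : ∀ u v, σ u v = σ v u)
    (htri : ∀ u v w, G.Adj u v → G.Adj v w → G.Adj u w → xor (σ u v) (σ v w) = σ u w)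
    (hhole : ∀ n g, 4 ≤ n → G.IsInducedCycle n g → g n = g 0 →
      ∃ f : ℕ → Bool, f n = f 0 ∧ ∀ i < n, σ (g i) (g (i + 1)) = xor (f i) (f (i + 1))) :
    ∃ s : V → Bool, ∀ u v, G.Adj u v → σ u v = xor (s u) (s v) := by
  have hw : ∀ v, ∃ _ : G.Walk (G.connectedComponentMk v).out v, True := fun v =>
    ⟨(ConnectedComponent.exact (Quot.out_eq (G.connectedComponentMk v))).some, trivial⟩
  choose p _ using hw
  refine ⟨fun v => (p v).parity σ, fun u v h => ?_⟩
  have e : G.connectedComponentMk u = G.connectedComponentMk v :=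
    ConnectedComponent.sound h.reachable
  have h1 := parity_closed_walk_eq_false hσ htri hhole _
    (((p u).append h.toWalk).append ((p v).reverse.copy rfl (by rw [e]))) rfl
  have h2 : ∀ {a b c : V} (q : G.Walk a b) (h : b = c), (q.copy rfl h).parity σ = q.parity σ := by
    rintro a b c q rfl; rfl
  rw [Walk.parity_append, h2, Walk.parity_reverse hσ, Walk.parity_append] at h1
  simp only [Walk.parity, Bool.xor_false] at h1
  revert h1
  beta_reduce
  cases (p u).parity σ <;> cases (p v).parity σ <;> cases σ u v <;> simp

end SimpleGraph

namespace SimpleGraph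
variable {V : Type*} {G : SimpleGraph V}

theorem _root_.Nat.succ_mod_cases {n : ℕ} (hn : 0 < n) (k : ℕ) :
    k % n < n ∧ (k % n + 1 < n ∧ (k + 1) % n = k % n + 1 ∨ k % n + 1 = n ∧ (k + 1) % n = 0) := by
  have h := Nat.mod_lt k hn
  refine ⟨h, ?_⟩
  rw [← Nat.mod_add_mod]
  rcases Nat.lt_or_ge (k % n + 1) n with h' | h'
  · exact .inl ⟨h', Nat.mod_eq_of_lt h'⟩
  · have : k % n + 1 = n := by omega
    exact .inr ⟨this, by rw [this, Nat.mod_self]⟩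

theorem IsInducedCycle.adj_mod {n : ℕ} {g : ℕ → V} (hn : 2 ≤ n) (hg : G.IsInducedCycle n g)
    (k : ℕ) : G.Adj (g (k % n)) (g ((k + 1) % n)) := by
  obtain ⟨h, ⟨h', e⟩ | ⟨h', e⟩⟩ := Nat.succ_mod_cases (n := n) (by omega) k
  · rw [e]; exact (hg _ _ (Nat.lt_succ_self _) h').2.2 (.inl rfl)
  · rw [e]; exact ((hg 0 (k % n) (by omega) h).2.2 (.inr ⟨rfl, h'⟩)).symm

theorem IsInducedCycle.coAdj_mod {n : ℕ} {g : ℕ → V} (hn : 4 ≤ n) (hg : G.IsInducedCycle n g)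
    (k : ℕ) : G.CoAdj (g (k % n)) (g ((k + 2) % n)) := by
  have key : ∀ i j, i < j → j < n → j ≠ i + 1 → ¬ (i = 0 ∧ j + 1 = n) → G.CoAdj (g i) (g j) :=
    fun i j hij hj h₁ h₂ => ⟨(hg i j hij hj).1, fun h => ((hg i j hij hj).2.1 h).elim h₁ h₂⟩
  have h1 := Nat.succ_mod_cases (n := n) (by omega) k
  have h2 := Nat.succ_mod_cases (n := n) (by omega) (k + 1)
  rw [show k + 1 + 1 = k + 2 from rfl] at h2
  rcases Nat.lt_or_ge (k % n) ((k + 2) % n) with h | h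
  · exact key _ _ h (Nat.mod_lt _ (by omega)) (by omega) (by omega)
  · exact (key _ _ (by omega) (Nat.mod_lt k (by omega)) (by omega) (by omega)).symm

theorem ForbiddenFree.exists_aligned_colorings (hG : G.ForbiddenFree) :
    ∃ o : V → V → Bool, (∀ v, G.IsLocalColoring v (o v)) ∧
      ∀ u v, G.Adj u v → (∃ c, G.Split u c) → (∃ c, G.Split v c) →
        G.Aligned u v (o u) (o v) := by
  classical
  choose t ht using hG.exists_isLocalColoring
  let H : SimpleGraph V :=
    { Adj := fun u v => G.Adj u v ∧ (∃ c, G.Split u c) ∧ ∃ c, G.Split v c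
      symm := ⟨fun u v h => ⟨h.1.symm, h.2.2, h.2.1⟩⟩
      loopless := ⟨fun u h => h.1.ne rfl⟩ }
  have hH : ∀ {u v}, H.Adj u v ↔ G.Adj u v ∧ (∃ c, G.Split u c) ∧ ∃ c, G.Split v c := Iff.rfl
  obtain ⟨s, hs⟩ := exists_potential (G := H) (σ := fun u v => !decide (G.Aligned u v (t u) (t v)))
    (fun u v => by
      have : G.Aligned u v (t u) (t v) ↔ G.Aligned v u (t v) (t u) :=
        ⟨Aligned.symm, Aligned.symm⟩
      simp [this])
    (by
      rintro u v w ⟨huv, hu, hv⟩ ⟨hvw, -, hw⟩ ⟨huw, -⟩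
      have T := hG.alignedTrans huv.symm hvw huw hv hu hw
      have a := hG.aligned_or_aligned_not (ht v) (ht u) huv.symm hv hu
      have b := hG.aligned_or_aligned_not (ht v) (ht w) hvw hv hw
      have a' := fun h : G.Aligned u v (t u) (t v) => h.symm
      by_cases h₁ : G.Aligned u v (t u) (t v) <;> by_cases h₂ : G.Aligned v w (t v) (t w)
      · have := T _ _ _ (ht v) (ht u) (ht w) h₁.symm h₂
        simp [h₁, h₂, this]
      · have := T _ _ _ (ht v) (ht u) (ht w).not h₁.symm (b.resolve_left h₂)
        have h₃ : ¬ G.Aligned u w (t u) (t w) := fun h => h.not_aligned_not huw hu hw this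
        simp [h₁, h₂, h₃]
      · have h₁' : ¬ G.Aligned v u (t v) (t u) := fun h => h₁ h.symm
        have := T _ _ _ (ht v) (ht u).not (ht w) (a.resolve_left h₁') h₂
        have h₃ : ¬ G.Aligned u w (t u) (t w) := fun h =>
          h.symm.not_aligned_not huw.symm hw hu this.symm
        simp [h₁, h₂, h₃]
      · have h₁' : ¬ G.Aligned v u (t v) (t u) := fun h => h₁ h.symm
        have := (T _ _ _ (ht v) (ht u).not (ht w).not (a.resolve_left h₁') (b.resolve_left h₂)).not
        have h₃ : G.Aligned u w (t u) (t w) := by simpa using this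
        simp [h₁, h₂, h₃])
    (by
      intro n g hn hg hgn
      have hg' : G.IsInducedCycle n g := by
        have hS : ∀ i < n, ∃ c, G.Split (g i) c := fun i hi => by
          have := (hg.adj_mod (by omega) i).2.1
          rwa [Nat.mod_eq_of_lt hi] at this
        intro i j hij hj
        have := hg i j hij hj
        rwa [hH, and_iff_left (And.intro (hS i (hij.trans hj)) (hS j hj))] at this
      have hadj := hg'.adj_mod (by omega)
      have hco := hg'.coAdj_mod hn
      refine ⟨fun k => t (g (k % n)) (g ((k + 1) % n)), by simp, fun i hi => ?_⟩
      have e : ∀ k ≤ n, g (k % n) = g k := fun k hk => by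
        rcases hk.lt_or_eq with h | rfl
        · rw [Nat.mod_eq_of_lt h]
        · simp [hgn]
      rw [← e i hi.le, ← e (i + 1) hi]
      have s₁ : G.Split (g ((i + 1) % n)) (g (i % n)) :=
        ⟨(hadj i).symm, _, hadj (i + 1), hco i⟩
      have s₂ : G.Split (g (i % n)) (g ((i + 1) % n)) := by
        obtain ⟨k, hk⟩ : ∃ k, (k + 1) % n = i % n := ⟨i + n - 1, by
          rw [show i + n - 1 + 1 = i + n by omega]; simp⟩
        have hk' : (k + 2) % n = (i + 1) % n := by
          rw [show k + 2 = k + 1 + 1 by rfl, ← Nat.mod_add_mod, hk, Nat.mod_add_mod]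
        have h1 := hadj k
        have h2 := hco k
        rw [hk] at h1
        rw [hk'] at h2
        exact ⟨hadj i, _, h1.symm, h2.symm⟩
      have h3 : t (g ((i + 1) % n)) (g (i % n)) ≠ t (g ((i + 1) % n)) (g ((i + 2) % n)) :=
        ht _ _ _ (hadj i).symm (hadj (i + 1)) (hco i)
      have h4 : G.Aligned (g (i % n)) (g ((i + 1) % n)) (t (g (i % n))) (t (g ((i + 1) % n))) ↔
          t (g (i % n)) (g ((i + 1) % n)) ≠ t (g ((i + 1) % n)) (g (i % n)) :=
        ⟨fun h => h.1 s₂ s₁, fun h => ⟨fun _ _ => h, fun h' => (h' ⟨s₂, s₁⟩).elim⟩⟩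
      simp only [h4]
      revert h3
      generalize t (g (i % n)) (g ((i + 1) % n)) = a, t (g ((i + 1) % n)) (g (i % n)) = b,
        t (g ((i + 1) % n)) (g ((i + 2) % n)) = c
      cases a <;> cases b <;> cases c <;> simp)
  refine ⟨fun v a => xor (s v) (t v a), fun v => (ht v).xor _, fun u v huv hu hv => ?_⟩
  have h := hs u v ⟨huv, hu, hv⟩
  have h' := hG.aligned_or_aligned_not (ht u) (ht v) huv hu hv
  by_cases ha : G.Aligned u v (t u) (t v)
  · cases h1 : s u <;> cases h2 : s v <;> simp [ha, h1, h2] at h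
    · simpa [h1, h2] using ha
    · simpa [h1, h2] using ha.not
  · have h' := h'.resolve_left ha
    cases h1 : s u <;> cases h2 : s v <;> simp [ha, h1, h2] at h
    · simpa [h1, h2] using h'
    · simpa [h1, h2] using h'.not

end SimpleGraph

namespace SimpleGraph
variable {V : Type*} {G : SimpleGraph V}

/-- An orientation of the edges in which in- and out-neighbourhoods are cliques and no triangle
is cyclic. -/
structure IsRoundOrientation (G : SimpleGraph V) (D : V → V → Prop) : Prop where
  adj_iff : ∀ u v, G.Adj u v ↔ D u v ∨ D v u
  asymm : ∀ u v, D u v → ¬ D v u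
  out_clique : ∀ v a b, D v a → D v b → a ≠ b → G.Adj a b
  in_clique : ∀ v a b, D a v → D b v → a ≠ b → G.Adj a b
  no_cyclic_triangle : ∀ a b c, D a b → D b c → ¬ D c a

/-- The orientation given by a family of local colourings, with ties broken by `r`. -/
def colorOrientation (G : SimpleGraph V) (o : V → V → Bool) (r : V → ℕ) (v u : V) : Prop :=
  G.Adj v u ∧ (G.Split v u ∧ o v u = true ∨ ¬ G.Split v u ∧ G.Split u v ∧ o u v = false ∨
    ¬ G.Split v u ∧ ¬ G.Split u v ∧ r v < r u)

section

variable {o : V → V → Bool} {r : V → ℕ}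
  (ha : ∀ u v, G.Adj u v → (∃ c, G.Split u c) → (∃ c, G.Split v c) → G.Aligned u v (o u) (o v))
include ha

theorem colorOrientation_iff_of_split {u v : V} (h : G.Split v u) :
    (G.colorOrientation o r v u ↔ o v u = true) ∧ (G.colorOrientation o r u v ↔ o v u = false) := by
  unfold colorOrientation
  by_cases h' : G.Split u v
  · have := (ha v u h.1 ⟨u, h⟩ ⟨v, h'⟩).1 h h'
    revert this
    cases o v u <;> cases o u v <;> simp [h, h', h.1, h.1.symm]
  · simp [h, h', h.1, h.1.symm]

theorem colorOrientation_asymm {u v : V} (h : G.colorOrientation o r u v) :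
    ¬ G.colorOrientation o r v u := by
  intro h'
  by_cases h₁ : G.Split u v
  · have := colorOrientation_iff_of_split (r := r) ha h₁
    simp_all
  by_cases h₂ : G.Split v u
  · have := colorOrientation_iff_of_split (r := r) ha h₂
    simp_all
  simp only [colorOrientation, h₁, h₂] at h h'
  simp at h h'
  omega

theorem colorOrientation_iff_iff {u v w : V} (huv : G.Adj u v) (h : ¬ G.Split u v)
    (huw : G.Split u w) :
    (G.colorOrientation o r u w ↔ G.colorOrientation o r v w) ∧
      (G.colorOrientation o r w u ↔ G.colorOrientation o r w v) := by
  have hvw := Split.of_not_split huv h huw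
  have e := (ha u v huv ⟨w, huw⟩ ⟨w, hvw⟩).eq_of_not_split huv h huw
  have h₁ := colorOrientation_iff_of_split (r := r) ha huw
  have h₂ := colorOrientation_iff_of_split (r := r) ha hvw
  rw [h₁.1, h₁.2, h₂.1, h₂.2, e]
  simp

theorem colorOrientation_iff_iff_of_private {u v w y : V} (ho : G.IsLocalColoring v (o v))
    (hvu : G.Adj v u) (hvw : G.Adj v w) (hvy : G.Adj v y) (huy : G.CoAdj u y)
    (hwy : G.CoAdj w y) :
    (G.colorOrientation o r v u ↔ G.colorOrientation o r v w) ∧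
      (G.colorOrientation o r u v ↔ G.colorOrientation o r w v) := by
  have e₁ := ho _ _ hvu hvy huy
  have e₂ := ho _ _ hvw hvy hwy
  have h₁ := colorOrientation_iff_of_split (r := r) ha ⟨hvu, y, hvy, huy⟩
  have h₂ := colorOrientation_iff_of_split (r := r) ha ⟨hvw, y, hvy, hwy⟩
  rw [h₁.1, h₁.2, h₂.1, h₂.2]
  revert e₁ e₂
  cases o v u <;> cases o v w <;> cases o v y <;> simp

theorem colorOrientation_not_cyclic_of_not_split (ho : ∀ v, G.IsLocalColoring v (o v))
    {u v w : V} (huv : G.Adj u v)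
    (huw : G.Adj u w) (hvw : G.Adj v w) (h : ¬ G.Split u v)
    (hc : G.colorOrientation o r u v ∧ G.colorOrientation o r v w ∧ G.colorOrientation o r w u ∨
      G.colorOrientation o r v u ∧ G.colorOrientation o r w v ∧ G.colorOrientation o r u w) :
    False := by
  have as₁ := @colorOrientation_asymm V G o r ha u v
  have as₂ := @colorOrientation_asymm V G o r ha u w
  have as₃ := @colorOrientation_asymm V G o r ha v w
  by_cases h₁ : G.Split u w
  · have := colorOrientation_iff_iff (r := r) ha huv h h₁
    tauto
  by_cases h₂ : G.Split v w
  · obtain ⟨-, y, hvy, hwy⟩ := h₂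
    have huy : G.CoAdj u y := ⟨fun e => hwy.2 (e ▸ huw.symm), fun e =>
      hwy.2 (adj_of_not_split huw h₁ e hwy.1.symm)⟩
    have := colorOrientation_iff_iff_of_private (r := r) ha (ho v) huv.symm hvw hvy huy hwy
    tauto
  by_cases h₃ : G.Split w v
  · obtain ⟨-, y, hwy, hvy⟩ := h₃
    have huy : G.CoAdj u y := ⟨fun e => hvy.2 (e ▸ huv.symm), fun e =>
      hvy.2 (adj_of_not_split huv h e hvy.1.symm)⟩
    have := colorOrientation_iff_iff_of_private (r := r) ha (ho w) huw.symm hvw.symm hwy huy hvy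
    tauto
  by_cases h₄ : G.Split v u
  · have := colorOrientation_iff_iff (r := r) ha hvw h₂ h₄
    tauto
  by_cases h₅ : G.Split w u
  · have := colorOrientation_iff_iff (r := r) ha hvw.symm h₃ h₅
    tauto
  simp only [colorOrientation, h, h₁, h₂, h₃, h₄, h₅, huv, huv.symm, huw, huw.symm, hvw,
    hvw.symm] at hc
  simp at hc
  omega

theorem ForbiddenFree.isRoundOrientation (hG : G.ForbiddenFree)
    (ho : ∀ v, G.IsLocalColoring v (o v)) (hr : Function.Injective r) :
    G.IsRoundOrientation (G.colorOrientation o r) where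
  adj_iff u v := by
    constructor
    · intro h
      by_cases h₁ : G.Split u v
      · have := colorOrientation_iff_of_split (r := r) ha h₁
        rw [this.1, this.2]; cases o u v <;> simp
      by_cases h₂ : G.Split v u
      · have := colorOrientation_iff_of_split (r := r) ha h₂
        rw [this.1, this.2]; cases o v u <;> simp
      have := hr.ne h.ne
      simp only [colorOrientation, h, h.symm, h₁, h₂]
      simp
      omega
    · rintro (h | h)
      exacts [h.1, h.1.symm]
  asymm u v h := colorOrientation_asymm ha h
  out_clique v a b hva hvb hab := by
    by_contra h
    have h₁ := (colorOrientation_iff_of_split ha ⟨hva.1, b, hvb.1, hab, h⟩).1.1 hva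
    have h₂ := (colorOrientation_iff_of_split ha ⟨hvb.1, a, hva.1, CoAdj.symm ⟨hab, h⟩⟩).1.1 hvb
    exact ho v a b hva.1 hvb.1 ⟨hab, h⟩ (h₁.trans h₂.symm)
  in_clique v a b hva hvb hab := by
    by_contra h
    have h₁ := (colorOrientation_iff_of_split ha
      ⟨hva.1.symm, b, hvb.1.symm, hab, h⟩).2.1 hva
    have h₂ := (colorOrientation_iff_of_split ha
      ⟨hvb.1.symm, a, hva.1.symm, CoAdj.symm ⟨hab, h⟩⟩).2.1 hvb
    exact ho v a b hva.1.symm hvb.1.symm ⟨hab, h⟩ (h₁.trans h₂.symm)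
  no_cyclic_triangle := by
    intro a b c hab hbc hca
    have key : ∀ a b c, G.colorOrientation o r a b → G.colorOrientation o r b c →
        G.colorOrientation o r c a → G.Split a b ∧ G.Split b a ∧
          ∃ x, G.Adj a x ∧ G.Adj c x ∧ G.CoAdj b x := by
      intro a b c hab hbc hca
      have h₁ : G.Split a b := by
        by_contra h
        exact colorOrientation_not_cyclic_of_not_split ha ho hab.1 hca.1.symm hbc.1 h
          (.inl ⟨hab, hbc, hca⟩)
      have h₂ : G.Split b a := by
        by_contra h
        exact colorOrientation_not_cyclic_of_not_split ha ho hab.1.symm hbc.1 hca.1.symm h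
          (.inr ⟨hab, hca, hbc⟩)
      refine ⟨h₁, h₂, ?_⟩
      obtain ⟨-, x, hax, hbx⟩ := h₁
      refine ⟨x, hax, ?_, hbx⟩
      by_contra h
      have hcx : G.CoAdj c x := ⟨fun e => hbx.2 (e ▸ hbc.1), h⟩
      have := colorOrientation_iff_iff_of_private (r := r) ha (ho a) hab.1 hca.1.symm hax hbx hcx
      exact colorOrientation_asymm ha hca (this.1.1 hab)
    obtain ⟨-, -, y, hay, hcy, hby⟩ := key a b c hab hbc hca
    obtain ⟨-, -, z, hbz, haz, hcz⟩ := key b c a hbc hca hab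
    obtain ⟨-, -, x, hcx, hbx, hax⟩ := key c a b hca hab hbc
    replace hab := hab.1
    replace hbc := hbc.1
    replace hca := hca.1
    have hxy : G.CoAdj x y := ⟨fun e => hax.2 (e ▸ hay), fun h =>
      false_of_wheel_four hG.wheel_four hca hbc.symm hcx hcy hab hbx h hay.symm hax hby⟩
    have hxz : G.CoAdj x z := ⟨fun e => hax.2 (e ▸ haz), fun h =>
      false_of_wheel_four hG.wheel_four hab.symm hbc hbx hbz hca.symm hcx h haz.symm hax hcz⟩
    have hyz : G.CoAdj y z := ⟨fun e => hby.2 (e ▸ hbz), fun h =>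
      false_of_wheel_four hG.wheel_four hab hca.symm hay haz hbc hcy h hbz.symm hby hcz⟩
    exact false_of_tent hG.tent hab hca.symm hbc hbx hcx hay hcy haz hbz hax hby hcz hxy hxz hyz

end

theorem ForbiddenFree.exists_isRoundOrientation [Finite V] (hG : G.ForbiddenFree) :
    ∃ D, G.IsRoundOrientation D := by
  obtain ⟨o, ho, ha⟩ := hG.exists_aligned_colorings
  obtain ⟨n, ⟨e⟩⟩ := Finite.exists_equiv_fin V
  exact ⟨_, hG.isRoundOrientation ha ho (Fin.val_injective.comp e.injective)⟩

end SimpleGraph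

namespace SimpleGraph
variable {V : Type*} {G : SimpleGraph V} {D : V → V → Prop}

/-- A finite nonempty transitive tournament has a source. -/
theorem _root_.Set.Finite.exists_source {S : Set V} (hS : S.Finite) (hne : S.Nonempty)
    (hcomp : ∀ a ∈ S, ∀ b ∈ S, a ≠ b → D a b ∨ D b a)
    (htri : ∀ a b c, D a b → D b c → ¬ D c a) :
    ∃ u ∈ S, ∀ x ∈ S, x ≠ u → D u x := by
  induction S, hS using Set.Finite.induction_on with
  | empty => exact (Set.not_nonempty_empty hne).elim
  | @insert a S ha hS ih =>
    rcases S.eq_empty_or_nonempty with rfl | hne'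
    · exact ⟨a, by simp, by simp⟩
    obtain ⟨u, hu, hu'⟩ := ih hne' fun a ha b hb => hcomp a (.inr ha) b (.inr hb)
    have hau : a ≠ u := fun h => ha (h ▸ hu)
    rcases hcomp a (.inl rfl) u (.inr hu) hau with h | h
    · refine ⟨a, .inl rfl, ?_⟩
      rintro x (rfl | hx) hxa
      · exact (hxa rfl).elim
      · by_cases hxu : x = u
        · exact hxu ▸ h
        · exact (hcomp a (.inl rfl) x (.inr hx) hxa.symm).resolve_right
            (htri _ _ _ h (hu' x hx hxu))
    · refine ⟨u, .inr hu, ?_⟩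
      rintro x (rfl | hx) hxu
      exacts [h, hu' x hx hxu]

/-- There is a `D`-chain with `m` steps from `u` to `v`. -/
def HasChain (D : V → V → Prop) (m : ℕ) (u v : V) : Prop :=
  ∃ g : ℕ → V, g 0 = u ∧ g m = v ∧ ∀ k < m, D (g k) (g (k + 1))

theorem HasChain.single {u v : V} (h : D u v) : HasChain D 1 u v :=
  ⟨fun k => if k = 0 then u else v, by simp, by simp, by simpa using h⟩

theorem HasChain.trans {u v w : V} {m k : ℕ} (h₁ : HasChain D m u v) (h₂ : HasChain D k v w) :
    HasChain D (m + k) u w := by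
  obtain ⟨g, rfl, rfl, hg⟩ := h₁
  obtain ⟨g', e, rfl, hg'⟩ := h₂
  refine ⟨fun i => if i ≤ m then g i else g' (i - m), by simp, ?_, ?_⟩
  · rcases Nat.eq_zero_or_pos k with rfl | hk
    · simp [e]
    · simp [hk.ne']
  · intro i hi
    rcases lt_trichotomy i m with h | rfl | h
    · simpa [h.le, Nat.succ_le_of_lt h] using hg i h
    · simpa [← e] using hg' 0 (by omega)
    · have := hg' (i - m) (by omega)
      simpa [h.not_ge, show ¬ i + 1 ≤ m by omega, show i + 1 - m = i - m + 1 by omega] using this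

theorem exists_hasChain_of_transGen {u v : V} (h : Relation.TransGen D u v) :
    ∃ m, 0 < m ∧ HasChain D m u v := by
  induction h with
  | single h => exact ⟨1, one_pos, .single h⟩
  | tail _ h ih =>
    obtain ⟨m, hm, h'⟩ := ih
    exact ⟨m + 1, by omega, h'.trans (.single h)⟩

namespace IsRoundOrientation

variable (hD : G.IsRoundOrientation D)
include hD

theorem irrefl (v : V) : ¬ D v v := fun h => hD.asymm _ _ h h

theorem adj {u v : V} (h : D u v) : G.Adj u v := (hD.adj_iff u v).2 (.inl h)

theorem reverse : G.IsRoundOrientation fun u v => D v u where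
  adj_iff u v := (hD.adj_iff u v).trans or_comm
  asymm u v := hD.asymm v u
  out_clique := hD.in_clique
  in_clique := hD.out_clique
  no_cyclic_triangle _ _ _ h₁ h₂ h₃ := hD.no_cyclic_triangle _ _ _ h₂ h₁ h₃

/-- A shortest directed cycle is induced. -/
theorem exists_directed_hole {v : V} (hv : Relation.TransGen D v v) :
    ∃ n g, 4 ≤ n ∧ G.IsInducedCycle n g ∧ ∀ k, D (g (k % n)) (g ((k + 1) % n)) := by
  classical
  obtain ⟨m, hm, hc⟩ := exists_hasChain_of_transGen hv
  have hex : ∃ n, 0 < n ∧ ∃ v, HasChain D n v v := ⟨m, hm, v, hc⟩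
  obtain ⟨hn, v, g, rfl, hlast, hg⟩ := Nat.find_spec hex
  have hmin : ∀ k v, 0 < k → HasChain D k v v → Nat.find hex ≤ k := fun k v hk h =>
    Nat.find_min' hex ⟨hk, v, h⟩
  generalize Nat.find hex = n at *
  have sub : ∀ i j, i ≤ j → j ≤ n → HasChain D (j - i) (g i) (g j) := fun i j hij hj =>
    ⟨fun k => g (i + k), by simp, by simp [hij], fun k hk => hg (i + k) (by omega)⟩
  refine ⟨n, g, ?_, ?_, ?_⟩
  · by_contra! hn'
    interval_cases n
    · have := hg 0 (by omega)
      exact hD.irrefl _ (hlast ▸ this)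
    · have h0 := hg 0 (by omega)
      have h1 := hg 1 (by omega)
      rw [hlast] at h1
      exact hD.asymm _ _ h0 h1
    · have h0 := hg 0 (by omega)
      have h1 := hg 1 (by omega)
      have h2 := hg 2 (by omega)
      rw [hlast] at h2
      exact hD.no_cyclic_triangle _ _ _ h0 h1 h2
  · intro i j hij hj
    refine ⟨fun h => ?_, fun h => ?_, ?_⟩
    · have := hmin (j - i) (g i) (by omega) (by simpa [h] using sub i j hij.le hj.le)
      omega
    · rcases (hD.adj_iff _ _).1 h with h | h
      · have h1 := (sub j n hj.le le_rfl)
        rw [hlast] at h1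
        have := hmin _ _ (by omega) ((h1.trans (sub 0 i (by omega) (by omega))).trans (.single h))
        omega
      · have := hmin _ _ (by omega) ((sub i j hij.le hj.le).trans (.single h))
        omega
    · rintro (rfl | ⟨rfl, rfl⟩)
      · exact hD.adj (hg i (by omega))
      · exact (hlast ▸ hD.adj (hg j (by omega))).symm
  · intro k
    obtain ⟨h, ⟨h', e⟩ | ⟨h', e⟩⟩ := Nat.succ_mod_cases hn k
    · rw [e]; exact hg _ h
    · rw [e, ← hlast]; have := hg _ h; rwa [h'] at this

/-- A round orientation with a directed cycle is strongly connected, unless some vertex is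
isolated from a hole. -/
theorem transGen_of_cyclic (hstar : ∀ n, 4 ≤ n → ¬ G.HasInducedCopy (cycleStarG n)) {v : V}
    (hv : Relation.TransGen D v v) (a b : V) : Relation.TransGen D a b := by
  obtain ⟨n, g, hn, hg, hDg⟩ := hD.exists_directed_hole hv
  have hco := hg.coAdj_mod hn
  have hmeet : ∀ v, ∃ k, v = g (k % n) ∨ D v (g (k % n)) ∨ D (g (k % n)) v := by
    intro v
    by_contra! h
    refine hstar n hn (hg.hasInducedCopy_cycleStarG (by omega) (h := v) fun i hi => ?_)
    have := h i
    rw [Nat.mod_eq_of_lt hi] at this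
    exact ⟨this.1, fun h' => ((hD.adj_iff _ _).1 h').elim this.2.1 this.2.2⟩
  have back : ∀ k, ∃ m, (m + 2) % n = k % n := fun k =>
    ⟨k + n - 2, by rw [show k + n - 2 + 2 = k + n by omega]; simp⟩
  have hout : ∀ v, ∃ k, D v (g (k % n)) := by
    intro v
    obtain ⟨k, rfl | h | h⟩ := hmeet v
    · exact ⟨k + 1, hDg k⟩
    · exact ⟨k, h⟩
    by_contra! hno
    have step : ∀ k, D (g (k % n)) v → D (g ((k + 1) % n)) v := by
      intro k h
      by_cases e : v = g ((k + 1) % n)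
      · exact (hno (k + 1 + 1) (e ▸ hDg (k + 1))).elim
      · exact ((hD.adj_iff _ _).1 (hD.out_clique _ _ _ h (hDg k) e)).resolve_left (hno _)
    exact (hco k).2 (hD.in_clique _ _ _ h (step _ (step _ h)) (hco k).1)
  have hin : ∀ v, ∃ k, D (g (k % n)) v := by
    intro v
    obtain ⟨k, rfl | h | h⟩ := hmeet v
    · obtain ⟨m, hm⟩ := back k
      exact ⟨m + 1, hm ▸ hDg (m + 1)⟩
    swap
    · exact ⟨k, h⟩
    by_contra! hno
    have step : ∀ k, D v (g ((k + 1) % n)) → D v (g (k % n)) := by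
      intro k h
      by_cases e : v = g (k % n)
      · obtain ⟨m, hm⟩ := back k
        exact (hno (m + 1) (by rw [e, ← hm]; exact hDg (m + 1))).elim
      · exact ((hD.adj_iff _ _).1 (hD.in_clique _ _ _ h (hDg k) e)).resolve_right (hno _)
    obtain ⟨m, hm⟩ := back k
    rw [← hm] at h
    exact (hco m).2 (hD.out_clique _ _ _ (step _ (step _ h)) h (hco m).1)
  have hcyc : ∀ i k, Relation.TransGen D (g (i % n)) (g ((i + (k + 1)) % n)) := by
    intro i k
    induction k with
    | zero => exact .single (hDg i)
    | succ k ih => exact ih.tail (hDg (i + (k + 1)))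
  obtain ⟨i, hi⟩ := hout a
  obtain ⟨j, hj⟩ := hin b
  have h := hcyc i (j + (i + 1) * n - i - 1)
  have hle : i + 1 ≤ (i + 1) * n := Nat.le_mul_of_pos_right _ (by omega)
  rw [show i + (j + (i + 1) * n - i - 1 + 1) = j + (i + 1) * n by omega,
    Nat.add_mul_mod_self_right] at h
  exact (Relation.TransGen.head hi h).tail hj

end IsRoundOrientation
end SimpleGraph

namespace SimpleGraph
variable {V : Type*} {G : SimpleGraph V} {D : V → V → Prop}

/-- The clockwise distance from `u` to `v` when vertices sit at positions `pos` modulo `n`. -/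
def clockwiseGap (n : ℤ) (pos : V → ℤ) (u v : V) : ℤ := (pos v - pos u) % n

/-- Positions of the vertices on a discrete circle for which every arc of `D` spans only vertices
between its ends. -/
structure IsCircularLayout (D : V → V → Prop) (n : ℤ) (pos : V → ℤ) : Prop where
  period_pos : 0 < n
  pos_nonneg : ∀ v, 0 ≤ pos v
  pos_lt : ∀ v, pos v < n
  injective : Function.Injective pos
  between : ∀ u v w, D u v → 0 < clockwiseGap n pos u w →
    clockwiseGap n pos u w < clockwiseGap n pos u v → D u w ∧ D w v

namespace IsRoundOrientation

variable (hD : G.IsRoundOrientation D)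
include hD

theorem exists_layout_of_transGen [Finite V] (r : V) (hs : ∀ a b, Relation.TransGen D a b) :
    ∃ n pos, IsCircularLayout D n pos := by
  have hf : ∀ v, ∃ u, D v u ∧ ∀ x, D v x → x ≠ u → D u x := by
    intro v
    obtain ⟨u, hu, hu'⟩ := (Set.toFinite {u | D v u}).exists_source (D := D)
      (by obtain ⟨w, hw, -⟩ := Relation.TransGen.head'_iff.1 (hs v v); exact ⟨w, hw⟩)
      (fun a ha b hb hab => (hD.adj_iff a b).1 (hD.out_clique v a b ha hb hab))
      hD.no_cyclic_triangle
    exact ⟨u, hu, hu'⟩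
  choose f hf hfirst using hf
  have hinj : Function.Injective f := by
    intro v w h
    by_contra hvw
    have hw := hf w
    rw [← h] at hw
    have key : ∀ a b, D a b → D b (f a) → False := fun a b hab hb =>
      hD.asymm _ _ hb (hfirst a b hab fun e => hD.irrefl b (by rw [← e] at hb; exact hb))
    rcases (hD.adj_iff v w).1 (hD.in_clique _ _ _ (hf v) hw hvw) with h' | h'
    · exact key v w h' hw
    · exact key w v h' (h ▸ hf v)
  have into : ∀ u v k, D u v → (∀ i, 0 < i → i ≤ k → f^[i] u ≠ v) → ∀ i ≤ k, D (f^[i] u) v := by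
    intro u v k huv hne i
    induction i with
    | zero => exact fun _ => huv
    | succ i ih =>
      intro hi
      rw [Function.iterate_succ_apply']
      refine hfirst _ _ (ih (by omega)) fun e => hne (i + 1) (by omega) hi ?_
      rw [Function.iterate_succ_apply', e]
  have outof : ∀ u v k, D u v → (∀ i, 0 < i → i ≤ k → f^[i] u ≠ v) →
      ∀ i, i + 1 ≤ k → D u (f^[i + 1] u) := by
    intro u v k huv hne i
    induction i with
    | zero => exact fun _ => hf u
    | succ i ih =>
      intro hi
      have h₁ := ih (by omega)
      have h₂ : D (f^[i + 1] u) (f^[i + 1 + 1] u) := by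
        rw [Function.iterate_succ_apply' f (i + 1)]; exact hf _
      have h₃ := into u v k huv hne _ hi
      by_cases e : u = f^[i + 1 + 1] u
      · rw [← e] at h₂
        exact (hD.asymm _ _ h₁ h₂).elim
      · exact ((hD.adj_iff _ _).1 (hD.in_clique _ _ _ huv h₃ e)).resolve_right
          (hD.no_cyclic_triangle _ _ _ h₁ h₂)
  have reach : ∀ u v, D u v → ∃ m, f^[m] u = v := by
    intro u v huv
    by_contra! hne
    obtain ⟨i, j, hij, e⟩ := Finite.exists_ne_map_eq_of_infinite fun i => f^[i] u
    wlog hlt : i < j generalizing i j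
    · exact this j i hij.symm e.symm (by omega)
    obtain ⟨k, rfl⟩ : ∃ k, j = k + 1 + i := ⟨j - i - 1, by omega⟩
    have h := outof (f^[i] u) v (k + 1) (into u v i huv (fun l _ _ => hne l) i le_rfl)
      (fun l _ _ => by rw [← Function.iterate_add_apply]; exact hne _) k le_rfl
    rw [← Function.iterate_add_apply, ← e] at h
    exact hD.irrefl _ h
  have orbit : ∀ v, ∃ m, f^[m] r = v := by
    intro v
    induction hs r v with
    | single h => exact reach _ _ h
    | tail _ h ih =>
      obtain ⟨m, rfl⟩ := ih
      obtain ⟨k, rfl⟩ := reach _ _ h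
      exact ⟨k + m, Function.iterate_add_apply ..⟩
  have hn : 0 < Function.minimalPeriod f r :=
    Function.minimalPeriod_pos_of_mem_periodicPts (hinj.mem_periodicPts r)
  choose m hm using orbit
  set n := Function.minimalPeriod f r with hn_def
  have hpos : ∀ v, f^[m v % n] r = v := fun v => by
    rw [Function.iterate_mod_minimalPeriod_eq, hm]
  have hgap : ∀ u v, 0 ≤ clockwiseGap n (fun v => (m v % n : ℕ)) u v ∧
      clockwiseGap n (fun v => (m v % n : ℕ)) u v < n ∧
      f^[(clockwiseGap n (fun v => (m v % n : ℕ)) u v).toNat] u = v := by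
    intro u v
    have hn' : (0 : ℤ) < n := by exact_mod_cast hn
    have h₁ : 0 ≤ clockwiseGap n (fun v => (m v % n : ℕ)) u v := Int.emod_nonneg _ hn'.ne'
    refine ⟨h₁, Int.emod_lt_of_pos _ hn', ?_⟩
    nth_rw 2 [← hpos u]
    rw [← Function.iterate_add_apply, ← Function.iterate_mod_minimalPeriod_eq, ← hn_def]
    convert hpos v using 2
    rw [← Nat.cast_inj (R := ℤ), Int.natCast_mod, Int.natCast_add, Int.toNat_of_nonneg h₁]
    simp [clockwiseGap]
  refine ⟨n, fun v => (m v % n : ℕ), by exact_mod_cast hn, fun v => by positivity,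
    fun v => by exact_mod_cast Nat.mod_lt _ hn, fun u v h => ?_, fun u v w huv h₁ h₂ => ?_⟩
  · rw [← hpos u, ← hpos v, Nat.cast_injective h]
  obtain ⟨-, -, hw⟩ := hgap u w
  obtain ⟨-, hvn, hv⟩ := hgap u v
  generalize clockwiseGap n (fun v => (m v % n : ℕ)) u w = a at *
  generalize clockwiseGap n (fun v => (m v % n : ℕ)) u v = b at *
  lift a to ℕ using h₁.le
  lift b to ℕ using (h₁.trans h₂).le
  simp only [Int.toNat_natCast] at hw hv
  norm_cast at h₁ h₂ hvn
  have hne : ∀ i, 0 < i → i ≤ a → f^[i] u ≠ v := by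
    intro i _ hi e
    rw [← hv, ← hpos u, ← Function.iterate_add_apply, ← Function.iterate_add_apply, add_comm i,
      add_comm b, Function.iterate_add_apply, Function.iterate_add_apply] at e
    have := Function.iterate_injOn_Iio_minimalPeriod (f := f) (x := r) (Set.mem_Iio.2 (by omega))
      (Set.mem_Iio.2 hvn) (hinj.iterate _ e)
    omega
  obtain ⟨c, rfl⟩ : ∃ c, a = c + 1 := ⟨a - 1, by omega⟩
  rw [← hw]
  exact ⟨outof u v (c + 1) huv hne c le_rfl, into u v (c + 1) huv hne _ le_rfl⟩

end IsRoundOrientation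
end SimpleGraph

namespace SimpleGraph
variable {V : Type*} {G : SimpleGraph V} {D : V → V → Prop}

namespace IsRoundOrientation

variable (hD : G.IsRoundOrientation D)
include hD

theorem comparable_of_transGen_of_adj {u v w : V} (huv : Relation.TransGen D v u) (hvw : D v w) :
    w = u ∨ Relation.TransGen D u w ∨ Relation.TransGen D w u := by
  induction huv using Relation.TransGen.head_induction_on with
  | single h =>
    by_cases e : w = u
    · exact .inl e
    · exact .inr (((hD.adj_iff _ _).1 (hD.out_clique _ _ _ hvw h e)).symm.imp .single .single)
  | @head v v' h h' ih =>
    by_cases e : w = v'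
    · exact .inr (.inr (e ▸ h'))
    · rcases (hD.adj_iff _ _).1 (hD.out_clique _ _ _ hvw h e) with h'' | h''
      · exact .inr (.inr (.head h'' h'))
      · exact ih h''

theorem comparable_of_reachable {u v : V} (h : G.Reachable u v) :
    v = u ∨ Relation.TransGen D u v ∨ Relation.TransGen D v u := by
  rw [reachable_iff_reflTransGen] at h
  induction h with
  | refl => exact .inl rfl
  | @tail v w _ h ih =>
    rcases (hD.adj_iff v w).1 h with h | h <;> rcases ih with rfl | ih | ih
    · exact .inr (.inl (.single h))
    · exact .inr (.inl (ih.tail h))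
    · exact hD.comparable_of_transGen_of_adj ih h
    · exact .inr (.inr (.single h))
    · rw [← Relation.transGen_swap] at ih
      have := hD.reverse.comparable_of_transGen_of_adj ih h
      simp only [← Relation.transGen_swap (r := D)] at this ⊢
      tauto
    · exact .inr (.inr (.head h ih))

theorem between_of_transGen (hac : ∀ v, ¬ Relation.TransGen D v v) {u v w : V}
    (huv : D u v) (huw : Relation.TransGen D u w) (hwv : Relation.TransGen D w v) :
    D u w ∧ D w v := by
  have hne : ∀ {x}, Relation.TransGen D x v → x ≠ v := fun h e => hac _ (e ▸ h)
  induction huw with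
  | single h =>
    refine ⟨h, ((hD.adj_iff _ _).1 (hD.out_clique _ _ _ h huv (hne hwv))).resolve_right
      fun h' => hac _ (hwv.tail h')⟩
  | @tail x w hux h ih =>
    obtain ⟨-, hxv⟩ := ih (.head h hwv)
    have hwv' : D w v := ((hD.adj_iff _ _).1 (hD.out_clique _ _ _ h hxv (hne hwv))).resolve_right
      fun h' => hac _ (hwv.tail h')
    have huw : Relation.TransGen D u w := .tail hux h
    exact ⟨((hD.adj_iff _ _).1 (hD.in_clique _ _ _ huv hwv'
      fun e => hac w (by rwa [e] at huw))).resolve_right fun h' => hac _ (huw.tail h'), hwv'⟩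

theorem exists_layout_of_acyclic [Finite V] (hac : ∀ v, ¬ Relation.TransGen D v v) :
    ∃ n pos, IsCircularLayout D n pos := by
  have : Finite G.ConnectedComponent := Quot.finite _
  obtain ⟨k, ⟨e⟩⟩ := Finite.exists_equiv_fin G.ConnectedComponent
  let p : V → ℕ := fun v => {u | Relation.TransGen D u v}.ncard
  let N : ℕ := Nat.card V + 1
  let key : V → ℕ := fun v => (e (G.connectedComponentMk v) : ℕ) * N + p v
  have hp : ∀ v, p v < N := fun v => Nat.lt_succ_of_le (Set.ncard_le_card _)
  have hlt : ∀ {u v}, Relation.TransGen D u v → p u < p v := fun {u v} h =>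
    Set.ncard_lt_ncard ⟨fun x hx => hx.trans h, fun h' => hac u (h' h)⟩
  have hcomp : ∀ v, key v / N = e (G.connectedComponentMk v) := fun v => by
    simp only [key]
    rw [mul_comm, Nat.mul_add_div (Nat.succ_pos _), Nat.div_eq_of_lt (hp v), add_zero]
  have hmod : ∀ v, key v % N = p v := fun v => by
    simp only [key]
    rw [mul_comm, Nat.mul_add_mod, Nat.mod_eq_of_lt (hp v)]
  have hreach : ∀ {u v}, key u / N = key v / N → G.Reachable u v := fun {u v} h => by
    rw [hcomp, hcomp] at h
    exact ConnectedComponent.exact (e.injective (Fin.ext h))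
  have hreach' : ∀ {u v}, G.Reachable u v → key u / N = key v / N := fun {u v} h => by
    rw [hcomp, hcomp, ConnectedComponent.sound h]
  have hkey : ∀ {u v}, Relation.TransGen D u v → G.Reachable u v → key u < key v :=
    fun {u v} h hr => by
      rw [← Nat.div_add_mod (key u) N, ← Nat.div_add_mod (key v) N, hreach' hr, hmod, hmod]
      have := hlt h
      omega
  have htrans : ∀ {u v}, key u < key v → G.Reachable u v → Relation.TransGen D u v := by
    intro u v h hr
    rcases hD.comparable_of_reachable hr with rfl | h' | h'
    · exact (lt_irrefl _ h).elim
    · exact h'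
    · exact (h.asymm (hkey h' hr.symm)).elim
  obtain ⟨n, hn⟩ := (Set.finite_range key).bddAbove
  have hn' : ∀ v, key v ≤ n := fun v => hn ⟨v, rfl⟩
  refine ⟨n + 1, fun v => key v, by positivity, fun v => by positivity, fun v => by have := hn' v; omega,
    fun u v h => ?_, fun u v w huv h₁ h₂ => ?_⟩
  · have h : key u = key v := Nat.cast_injective h
    have hr : G.Reachable u v := hreach (by rw [h])
    rcases hD.comparable_of_reachable hr with rfl | h' | h'
    · rfl
    · exact (h.not_lt (hkey h' hr)).elim
    · exact (h.not_gt (hkey h' hr.symm)).elim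
  · have hr := (hD.adj huv).reachable
    have := hkey (.single huv) hr
    have := hn' u; have := hn' v; have := hn' w
    simp only [clockwiseGap] at h₁ h₂
    rw [Int.emod_eq_of_lt (a := (key v : ℤ) - key u) (by omega) (by omega)] at h₂
    have hw : key u < key w ∧ key w < key v := by
      rcases lt_or_ge (key w) (key u) with h | h
      · rw [← Int.add_emod_right, Int.emod_eq_of_lt (by omega) (by omega)] at h₁ h₂
        omega
      · rw [Int.emod_eq_of_lt (by omega) (by omega)] at h₁ h₂
        omega
    have hruw : G.Reachable u w := by
      refine hreach (le_antisymm (Nat.div_le_div_right hw.1.le) ?_)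
      rw [hreach' hr]
      exact Nat.div_le_div_right hw.2.le
    exact hD.between_of_transGen hac huv (htrans hw.1 hruw) (htrans hw.2 (hruw.symm.trans hr))

theorem exists_layout [Finite V] (hstar : ∀ n, 4 ≤ n → ¬ G.HasInducedCopy (cycleStarG n)) :
    ∃ n pos, IsCircularLayout D n pos := by
  by_cases h : ∃ v, Relation.TransGen D v v
  · obtain ⟨v, hv⟩ := h
    exact hD.exists_layout_of_transGen v (hD.transGen_of_cyclic hstar hv)
  · exact hD.exists_layout_of_acyclic (not_exists.1 h)

end IsRoundOrientation
end SimpleGraph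

theorem AddCircle.coe_eq_coe_iff_exists {p x y : ℝ} :
    (x : AddCircle p) = y ↔ ∃ k : ℤ, x + k * p = y := by
  rw [eq_comm, ← sub_eq_zero, ← AddCircle.coe_sub, AddCircle.coe_eq_zero_iff]
  simp only [zsmul_eq_mul, eq_sub_iff_add_eq']

namespace PreArcModel
variable {V : Type*} (A : PreArcModel V)

theorem coe_mem_arc {v : V} {x : ℝ} : (x : AddCircle A.L) ∈ A.arc v ↔
    ∃ k : ℤ, A.src v ≤ x + k * A.L ∧ x + k * A.L ≤ A.src v + A.len v := by
  simp only [arc, Set.mem_image, Set.mem_Icc, eq_comm (b := (x : AddCircle A.L)),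
    AddCircle.coe_eq_coe_iff_exists]
  constructor
  · rintro ⟨_, h, k, rfl⟩
    exact ⟨k, h⟩
  · rintro ⟨k, h⟩
    exact ⟨_, h, k, rfl⟩

theorem ccp_mem_arc (v : V) : A.ccp v ∈ A.arc v :=
  A.coe_mem_arc.2 ⟨0, by simp [(A.len_pos v).le]⟩

theorem cp_mem_arc (v : V) : A.cp v ∈ A.arc v :=
  A.coe_mem_arc.2 ⟨0, by simp [(A.len_pos v).le]⟩

/-- If two arcs meet then one of them starts inside the other. -/
theorem ccp_mem_arc_or {u v : V} {x : AddCircle A.L} (hu : x ∈ A.arc u) (hv : x ∈ A.arc v) :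
    A.ccp v ∈ A.arc u ∨ A.ccp u ∈ A.arc v := by
  induction x using QuotientAddGroup.induction_on with
  | H x =>
    obtain ⟨k, h₁, h₂⟩ := A.coe_mem_arc.1 hu
    obtain ⟨l, h₃, h₄⟩ := A.coe_mem_arc.1 hv
    rcases le_total (A.src u) (A.src v + (k - l) * A.L) with h | h
    · refine .inl (A.coe_mem_arc.2 ⟨k - l, ?_⟩)
      push_cast
      constructor <;> linarith
    · refine .inr (A.coe_mem_arc.2 ⟨l - k, ?_⟩)
      push_cast
      constructor <;> linarith

end PreArcModel

namespace SimpleGraph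
variable {V : Type*} {G : SimpleGraph V} {D : V → V → Prop} {n : ℤ} {pos : V → ℤ}

theorem clockwiseGap_eq {u v : V} {k : ℤ} (h₀ : 0 ≤ pos v - pos u + k * n)
    (h : pos v - pos u + k * n < n) : clockwiseGap n pos u v = pos v - pos u + k * n := by
  rw [clockwiseGap, ← Int.add_mul_emod_self_right _ k, Int.emod_eq_of_lt h₀ h]

theorem exists_clockwiseGap_eq (u v : V) :
    ∃ k, clockwiseGap n pos u v = pos v - pos u + k * n := by
  refine ⟨-((pos v - pos u) / n), ?_⟩
  have := Int.emod_add_mul_ediv (pos v - pos u) n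
  rw [clockwiseGap]; linarith

namespace IsCircularLayout

variable (hp : IsCircularLayout D n pos)
include hp

theorem clockwiseGap_nonneg (u v : V) : 0 ≤ clockwiseGap n pos u v :=
  Int.emod_nonneg _ hp.period_pos.ne'

theorem clockwiseGap_lt (u v : V) : clockwiseGap n pos u v < n :=
  Int.emod_lt_of_pos _ hp.period_pos

theorem eq_of_clockwiseGap_eq {u v w : V} (h : clockwiseGap n pos u v = clockwiseGap n pos u w) :
    v = w := by
  refine hp.injective ?_
  have h : pos v - pos u ≡ pos w - pos u [ZMOD n] := h
  have h := Int.ModEq.add_right_cancel' _ (by simpa only [sub_eq_add_neg] using h)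
  rwa [Int.ModEq, Int.emod_eq_of_lt (hp.pos_nonneg v) (hp.pos_lt v),
    Int.emod_eq_of_lt (hp.pos_nonneg w) (hp.pos_lt w)] at h

theorem clockwiseGap_pos {u v : V} (h : u ≠ v) : 0 < clockwiseGap n pos u v :=
  (hp.clockwiseGap_nonneg u v).lt_of_ne fun h' =>
    h (hp.eq_of_clockwiseGap_eq (u := u) (by rw [← h']; simp [clockwiseGap]))

theorem exists_reach [Finite V] (hirr : ∀ v, ¬ D v v) : ∃ d : V → ℤ, ∀ v, 0 ≤ d v ∧ d v < n ∧
    (∀ u, u ≠ v → (D v u ↔ clockwiseGap n pos v u ≤ d v)) ∧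
    ∀ u, D v u → d v ≤ clockwiseGap n pos v u ∨
      ∃ m, D u m ∧ d v = clockwiseGap n pos v u + clockwiseGap n pos u m := by
  have key : ∀ v, ∃ d : ℤ, 0 ≤ d ∧ d < n ∧ (∀ u, u ≠ v → (D v u ↔ clockwiseGap n pos v u ≤ d)) ∧
      ∀ u, D v u → d ≤ clockwiseGap n pos v u ∨
        ∃ m, D u m ∧ d = clockwiseGap n pos v u + clockwiseGap n pos u m := by
    intro v
    rcases Set.eq_empty_or_nonempty {u | D v u} with h | h
    · have h : ∀ u, ¬ D v u := fun u hu => (h ▸ hu : u ∈ (∅ : Set V))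
      refine ⟨0, le_rfl, hp.period_pos, fun u hu => ?_, fun u hu => (h u hu).elim⟩
      simp [h, hp.clockwiseGap_pos hu.symm]
    · obtain ⟨m, hm, hmax⟩ := Set.exists_max_image _ (clockwiseGap n pos v) (Set.toFinite _) h
      refine ⟨clockwiseGap n pos v m, hp.clockwiseGap_nonneg _ _, hp.clockwiseGap_lt _ _,
        fun u hu => ⟨hmax u, fun hle => ?_⟩, fun u hu => ?_⟩
      · rcases hle.lt_or_eq with hlt | heq
        · exact (hp.between _ _ _ hm (hp.clockwiseGap_pos hu.symm) hlt).1
        · exact hp.eq_of_clockwiseGap_eq heq ▸ hm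
      · refine or_iff_not_imp_left.2 fun hlt => ?_
        have hpos := hp.clockwiseGap_pos (u := v) (v := u) fun e => hirr u (e ▸ hu)
        refine ⟨m, (hp.between _ _ _ hm hpos (not_le.1 hlt)).2, ?_⟩
        obtain ⟨k, hk⟩ := exists_clockwiseGap_eq (n := n) (pos := pos) v m
        obtain ⟨l, hl⟩ := exists_clockwiseGap_eq (n := n) (pos := pos) v u
        have hlt' := hp.clockwiseGap_lt v m
        rw [clockwiseGap_eq (u := u) (v := m) (k := k - l)] <;> linarith
  choose d hd using key
  exact ⟨d, hd⟩

end IsCircularLayout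

/-- Arcs of lengths `(d v + 1) * n` starting at multiples of `n + 1` on a circle of length
`n * (n + 1)`. -/
def layoutModel (n : ℤ) (pos d : V → ℤ) (hn : 0 < n) (hd : ∀ v, 0 ≤ d v) (hd' : ∀ v, d v < n) :
    PreArcModel V where
  L := (n * (n + 1) : ℤ)
  L_pos := by have : 0 < n * (n + 1) := by positivity
              exact_mod_cast this
  src v := (pos v * (n + 1) : ℤ)
  len v := ((d v + 1) * n : ℤ)
  len_pos v := by have := hd v
                  have : 0 < (d v + 1) * n := by positivity
                  exact_mod_cast this
  len_lt v := by have := hd' v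
                 have : (d v + 1) * n < n * (n + 1) := by nlinarith
                 exact_mod_cast this

section layoutModel
variable {d : V → ℤ} (hn : 0 < n) (hd : ∀ v, 0 ≤ d v) (hd' : ∀ v, d v < n)

theorem coe_mem_arc_layoutModel {x : ℤ} {v : V} :
    ((x : ℝ) : AddCircle _) ∈ (layoutModel n pos d hn hd hd').arc v ↔
    ∃ k : ℤ, pos v * (n + 1) ≤ x + k * (n * (n + 1)) ∧
      x + k * (n * (n + 1)) ≤ pos v * (n + 1) + (d v + 1) * n := by
  rw [PreArcModel.coe_mem_arc]
  simp only [layoutModel]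
  norm_cast

theorem ccp_mem_arc_layoutModel {u v : V} :
    (layoutModel n pos d hn hd hd').ccp u ∈ (layoutModel n pos d hn hd hd').arc v ↔
      clockwiseGap n pos v u ≤ d v := by
  refine (coe_mem_arc_layoutModel hn hd hd').trans ⟨?_, fun h => ?_⟩
  · rintro ⟨k, h₁, h₂⟩
    have := hd' v
    have h₃ : 0 ≤ pos u - pos v + k * n := by nlinarith
    have h₄ : pos u - pos v + k * n ≤ d v := by
      by_contra! h
      have := hd v
      nlinarith
    rwa [clockwiseGap_eq h₃ (by omega)]
  · have h₀ : 0 ≤ clockwiseGap n pos v u := Int.emod_nonneg _ hn.ne'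
    obtain ⟨k, hk⟩ := exists_clockwiseGap_eq (n := n) (pos := pos) v u
    have := hd' v
    rw [hk] at h h₀
    exact ⟨k, by nlinarith, by nlinarith⟩

theorem endpointsDistinct_layoutModel (h₀ : ∀ v, 0 ≤ pos v) (h₁ : ∀ v, pos v < n)
    (hinj : Function.Injective pos) : (layoutModel n pos d hn hd hd').EndpointsDistinct := by
  have cast : ∀ x y : ℤ, ((x : ℝ) : AddCircle (layoutModel n pos d hn hd hd').L) = (y : ℝ) →
      ∃ k : ℤ, x + k * (n * (n + 1)) = y := by
    intro x y h
    obtain ⟨k, hk⟩ := AddCircle.coe_eq_coe_iff_exists.1 h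
    exact ⟨k, by simp only [layoutModel] at hk; exact_mod_cast hk⟩
  have starts : ∀ u v k, pos u + k * n = pos v → u = v := by
    intro u v k h
    have := h₀ u; have := h₀ v; have := h₁ u; have := h₁ v
    have hk : k = 0 := by
      by_contra hk
      rcases lt_or_gt_of_ne hk with hk | hk <;> nlinarith
    exact hinj (by simpa [hk] using h)
  have mixed : ∀ u v,
      (layoutModel n pos d hn hd hd').ccp u ≠ (layoutModel n pos d hn hd hd').cp v := by
    intro u v h
    rw [PreArcModel.cp] at h
    obtain ⟨k, hk⟩ := cast (pos u * (n + 1)) (pos v * (n + 1) + (d v + 1) * n)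
      (h.trans (by simp [layoutModel]))
    have hdvd : n + 1 ∣ d v + 1 := ⟨d v + 1 - (pos u + k * n - pos v), by linear_combination hk⟩
    have := hd v; have := hd' v
    have := Int.le_of_dvd (by omega) hdvd
    omega
  have ends : ∀ u v, (layoutModel n pos d hn hd hd').cp u = (layoutModel n pos d hn hd hd').cp v →
      u = v := by
    intro u v h
    rw [PreArcModel.cp, PreArcModel.cp] at h
    obtain ⟨k, hk⟩ := cast (pos u * (n + 1) + (d u + 1) * n) (pos v * (n + 1) + (d v + 1) * n)
      (by simpa [layoutModel] using h)
    have hdvd : n + 1 ∣ d v - d u :=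
      ⟨d v - d u - (pos u + k * n - pos v), by linear_combination hk⟩
    have := hd u; have := hd' u; have := hd v; have := hd' v
    have e : d v - d u = 0 := Int.eq_zero_of_abs_lt_dvd hdvd (by rw [abs_lt]; omega)
    refine starts u v k ?_
    have : (n + 1) * (pos u + k * n - pos v) = 0 := by linear_combination hk + n * e
    rcases mul_eq_zero.1 this with h | h <;> omega
  rintro ⟨u, _ | _⟩ ⟨v, _ | _⟩ h
  · obtain ⟨k, hk⟩ := cast (pos u * (n + 1)) (pos v * (n + 1)) h
    have : (n + 1) * (pos u + k * n - pos v) = 0 := by linear_combination hk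
    rw [starts u v k (by rcases mul_eq_zero.1 this with h | h <;> omega)]
  · exact (mixed _ _ h).elim
  · exact (mixed _ _ h.symm).elim
  · exact congrArg (·, true) (ends _ _ h)

end layoutModel

theorem IsRoundOrientation.isPHCA_of_layout [Finite V] (hD : G.IsRoundOrientation D)
    (hp : IsCircularLayout D n pos) : G.IsPHCA := by
  obtain ⟨d, hd⟩ := hp.exists_reach hD.irrefl
  have hn := hp.period_pos
  have hadj : ∀ u v, u ≠ v → (G.Adj u v ↔ ((layoutModel n pos d hn (fun v => (hd v).1)
      fun v => (hd v).2.1).arc u ∩ (layoutModel n pos d hn (fun v => (hd v).1)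
      fun v => (hd v).2.1).arc v).Nonempty) := by
    intro u v huv
    rw [hD.adj_iff, (hd u).2.2.1 v huv.symm, (hd v).2.2.1 u huv,
      ← ccp_mem_arc_layoutModel hn (fun v => (hd v).1) fun v => (hd v).2.1,
      ← ccp_mem_arc_layoutModel hn (fun v => (hd v).1) fun v => (hd v).2.1]
    refine ⟨?_, fun ⟨x, hu, hv⟩ => PreArcModel.ccp_mem_arc_or _ hu hv⟩
    rintro (h | h)
    · exact ⟨_, h, PreArcModel.ccp_mem_arc _ _⟩
    · exact ⟨_, PreArcModel.ccp_mem_arc _ _, h⟩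
  refine ⟨layoutModel n pos d hn (fun v => (hd v).1) fun v => (hd v).2.1,
    ⟨endpointsDistinct_layoutModel hn _ _ hp.pos_nonneg hp.pos_lt hp.injective, hadj⟩, ?_, ?_⟩
  · intro u v h
    have huv : u ≠ v := by rintro rfl; exact ssubset_irrefl _ h
    have h₁ := (ccp_mem_arc_layoutModel ..).1 (h.1 (PreArcModel.ccp_mem_arc _ u))
    have hvu : D v u := ((hd v).2.2.1 u huv).2 h₁
    obtain ⟨k, h₂, h₃⟩ := (coe_mem_arc_layoutModel (x := pos u * (n + 1) + (d u + 1) * n)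
      hn (fun v => (hd v).1) fun v => (hd v).2.1).1 (by
        convert h.1 (PreArcModel.cp_mem_arc _ u)
        simp [PreArcModel.cp, layoutModel])
    have hle : d v ≤ clockwiseGap n pos v u + d u := by
      rcases (hd v).2.2.2 u hvu with h | ⟨m, hm, e⟩
      · have := (hd u).1; omega
      · have := ((hd u).2.2.1 m fun e => hD.irrefl u (e ▸ hm)).1 hm
        omega
    have hg := hp.clockwiseGap_pos huv.symm
    have hg' := hp.clockwiseGap_lt v u
    have hnd : d u < n - clockwiseGap n pos v u := by
      by_contra! hge
      refine hD.asymm _ _ hvu (((hd u).2.2.1 v huv.symm).2 ?_)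
      obtain ⟨l, hl⟩ := exists_clockwiseGap_eq (n := n) (pos := pos) v u
      rw [clockwiseGap_eq (k := 1 - l)] <;> linarith
    obtain ⟨l, hl⟩ := exists_clockwiseGap_eq (n := n) (pos := pos) v u
    have hdu := hd u
    rw [← sub_eq_iff_eq_add] at hl
    generalize clockwiseGap n pos v u = g at *
    have hk : k - l < 0 := by
      by_contra! hk
      nlinarith [mul_nonneg hk (mul_pos hn (by omega : 0 < n + 1)).le]
    have : (n - g) * (n + 1) ≤ (d u + 1) * n := by
      nlinarith [mul_le_mul_of_nonneg_right (show k - l ≤ -1 by omega)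
        (mul_pos hn (by omega : 0 < n + 1)).le]
    nlinarith
  · intro S hS
    rcases S.eq_empty_or_nonempty with rfl | hne
    · simp
    obtain ⟨t, -, ht⟩ := S.toFinite.exists_source (D := fun u v => D v u) hne
      (fun a ha b hb hab => (hD.reverse.adj_iff a b).1 ((hadj a b hab).2 (hS a ha b hb)))
      hD.reverse.no_cyclic_triangle
    refine ⟨PreArcModel.ccp _ t, Set.mem_iInter₂.2 fun v hv => ?_⟩
    by_cases e : v = t
    · exact e ▸ PreArcModel.ccp_mem_arc _ _
    · exact (ccp_mem_arc_layoutModel ..).2 (((hd v).2.2.1 t (Ne.symm e)).1 (ht v ‹_› e))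

theorem ForbiddenFree.isPHCA [Finite V] (hG : G.ForbiddenFree) : G.IsPHCA := by
  obtain ⟨D, hD⟩ := hG.exists_isRoundOrientation
  obtain ⟨n, pos, hp⟩ := hD.exists_layout hG.cycleStar
  exact hD.isPHCA_of_layout hp

end SimpleGraph

namespace PreArcModel
variable {V W : Type*} (A : PreArcModel V)

/-- The arcs of the vertices in the range of `f`. -/
def comap (f : W → V) : PreArcModel W where
  L := A.L
  L_pos := A.L_pos
  src := A.src ∘ f
  len := A.len ∘ f
  len_pos _ := A.len_pos _
  len_lt _ := A.len_lt _

variable {A}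

theorem ccp_mem_arc_iff {u v : V} : A.ccp v ∈ A.arc u ↔
    ∃ k : ℤ, A.src u ≤ A.src v + k * A.L ∧ A.src v + k * A.L ≤ A.src u + A.len u :=
  A.coe_mem_arc

variable (hA : A.EndpointsDistinct) (hP : A.Proper)

include hA in
theorem EndpointsDistinct.src_ne {u v : V} (huv : u ≠ v) (k : ℤ) :
    A.src u ≠ A.src v + k * A.L := fun h =>
  huv (congrArg Prod.fst (hA (a₁ := (u, false)) (a₂ := (v, false))
    (AddCircle.coe_eq_coe_iff_exists.2 ⟨k, h.symm⟩).symm))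

include hA hP in
/-- In a proper model, the arc starting later ends later. -/
theorem Proper.end_lt_end {u v : V} (huv : u ≠ v) {k : ℤ} (h : A.src u ≤ A.src v + k * A.L) :
    A.src u + A.len u < A.src v + k * A.L + A.len v := by
  by_contra! h'
  refine hP v u ⟨?_, fun hsub => ?_⟩
  · rintro _ ⟨x, ⟨h₁, h₂⟩, rfl⟩
    exact A.coe_mem_arc.2 ⟨k, by linarith, by linarith⟩
  · obtain ⟨l, h₁, h₂⟩ := ccp_mem_arc_iff.1 (hsub (A.ccp_mem_arc u))
    have hne := hA.src_ne huv k
    have hlt := h.lt_of_ne hne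
    have := A.len_lt u
    have hL := A.L_pos
    have h₃ : (l + k : ℝ) * A.L < 1 * A.L := by linarith
    have h₄ : (0 : ℝ) * A.L < (l + k : ℝ) * A.L := by linarith
    have h₃ := lt_of_mul_lt_mul_right h₃ hL.le
    have h₄ := lt_of_mul_lt_mul_right h₄ hL.le
    norm_cast at h₃ h₄
    omega

include hA in
/-- An infinite sequence of arcs, each starting inside the previous one, covers the circle. -/
theorem EndpointsDistinct.exists_mem_arc [Finite V] {f : ℕ → V} (hf : ∀ i, f i ≠ f (i + 1))
    (hf' : ∀ i, A.ccp (f (i + 1)) ∈ A.arc (f i)) (x : AddCircle A.L) : ∃ i, x ∈ A.arc (f i) := by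
  choose k hk hk' using fun i => ccp_mem_arc_iff.1 (hf' i)
  let K : ℕ → ℤ := fun i => ∑ j ∈ Finset.range i, k j
  let s : ℕ → ℝ := fun i => A.src (f i) + K i * A.L
  have hs : StrictMono s := by
    refine strictMono_nat_of_lt_succ fun i => ?_
    have := (hk i).lt_of_ne (hA.src_ne (hf i) (k i))
    simp only [s, K, Finset.sum_range_succ]
    push_cast
    linarith
  have hs' : ∀ i, s (i + 1) ≤ s i + A.len (f i) := by
    intro i
    have := hk' i
    simp only [s, K, Finset.sum_range_succ]
    push_cast
    linarith
  have hL := A.L_pos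
  obtain ⟨i, j, hij, e⟩ := Finite.exists_ne_map_eq_of_infinite f
  wlog hlt : i < j generalizing i j
  · exact this j i hij.symm e.symm (by omega)
  have hwrap : s i + A.L ≤ s j := by
    have h := hs hlt
    simp only [s, e] at h ⊢
    have h : (K i : ℝ) * A.L < K j * A.L := by linarith
    have h := lt_of_mul_lt_mul_right h hL.le
    have h : (K i + 1 : ℝ) ≤ K j := by exact_mod_cast h
    nlinarith
  induction x using QuotientAddGroup.induction_on with
  | H x =>
    obtain ⟨y, hy, hyx⟩ : ∃ y ∈ Set.Ico (s i) (s i + A.L), (x : AddCircle A.L) = y := by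
      have : Fact (0 < A.L) := ⟨hL⟩
      obtain ⟨y, hy, e⟩ := (AddCircle.coe_image_Ico_eq A.L (s i)).symm ▸ Set.mem_univ
        (x : AddCircle A.L)
      exact ⟨y, hy, e.symm⟩
    have hex : ∃ m, y < s m := ⟨j, hy.2.trans_le hwrap⟩
    classical
    have h₁ := Nat.find_spec hex
    have h₂ := fun m => Nat.find_min hex (m := m)
    generalize Nat.find hex = m at *
    have him : i < m := by
      by_contra! h
      exact (hy.1.trans_lt h₁).not_ge (hs.monotone h)
    obtain ⟨m, rfl⟩ : ∃ m', m = m' + 1 := ⟨m - 1, by omega⟩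
    refine ⟨m, ?_⟩
    change (x : AddCircle A.L) ∈ _
    rw [hyx, coe_mem_arc]
    have h₃ := not_lt.1 (h₂ m (by omega))
    have h₄ := hs' m
    refine ⟨-K m, ?_⟩
    simp only [s] at h₁ h₃ h₄
    push_cast
    constructor <;> linarith

/-- Distinct `u` and `v` such that the arc of `v` starts inside the arc of `u`. -/
def Precedes (A : PreArcModel V) (u v : V) : Prop := u ≠ v ∧ A.ccp v ∈ A.arc u

theorem IsModelOf.adj_iff_precedes {G : SimpleGraph V} (hG : A.IsModelOf G) (u v : V) :
    G.Adj u v ↔ A.Precedes u v ∨ A.Precedes v u := by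
  by_cases e : u = v
  · subst e; simp [Precedes]
  rw [hG.2 u v e]
  constructor
  · rintro ⟨x, hu, hv⟩
    exact (A.ccp_mem_arc_or hu hv).imp (⟨e, ·⟩) (⟨Ne.symm e, ·⟩)
  · rintro (h | h)
    · exact ⟨_, h.2, A.ccp_mem_arc v⟩
    · exact ⟨_, A.ccp_mem_arc u, h.2⟩

include hP in
theorem Proper.adj_of_precedes_of_precedes [Finite V] {G : SimpleGraph V} (hG : A.IsModelOf G)
    {u v w : V} (huv : A.Precedes u v) (hvu : A.Precedes v u) (hw : w ≠ u) : G.Adj u w := by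
  have hcov : ∀ x, x ∈ A.arc u ∨ x ∈ A.arc v := by
    intro x
    obtain ⟨i, hi⟩ := hG.1.exists_mem_arc (f := fun i => if Even i then u else v)
      (fun i => by by_cases h : Even i <;> simp [h, Nat.even_add_one, huv.1, hvu.1])
      (fun i => by by_cases h : Even i <;> simp [h, Nat.even_add_one, huv.2, hvu.2]) x
    split_ifs at hi
    exacts [.inl hi, .inr hi]
  by_contra hadj
  have hdisj : ∀ x ∈ A.arc w, x ∉ A.arc u := fun x hx hx' =>
    hadj ((hG.2 u w hw.symm).2 ⟨x, hx', hx⟩)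
  exact hP w v ⟨fun x hx => (hcov x).resolve_left (hdisj x hx),
    fun h => hdisj _ (h (A.ccp_mem_arc v)) huv.2⟩

theorem isRoundOrientation_precedes [Finite V] {G : SimpleGraph V} (hG : A.IsModelOf G)
    (hP : A.Proper) (hH : A.Helly)
    (huniv : ∀ u v, (∀ w, w ≠ u → G.Adj u w) → (∀ w, w ≠ v → G.Adj v w) → u = v) :
    G.IsRoundOrientation A.Precedes := by
  have hasymm : ∀ u v, A.Precedes u v → ¬ A.Precedes v u := fun u v h h' =>
    h.1 (huniv u v (fun _ => hP.adj_of_precedes_of_precedes hG h h')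
      fun _ => hP.adj_of_precedes_of_precedes hG h' h)
  refine ⟨hG.adj_iff_precedes, hasymm, fun v a b ha hb hab => ?_, fun v a b ha hb hab => ?_,
    fun a b c hab hbc hca => ?_⟩
  · have key : ∀ a, A.Precedes v a → A.cp v ∈ A.arc a := by
      intro a ha
      obtain ⟨k, h₁, h₂⟩ := ccp_mem_arc_iff.1 ha.2
      have := hP.end_lt_end hG.1 ha.1 h₁
      exact A.coe_mem_arc.2 ⟨-k, by push_cast; linarith, by push_cast; linarith⟩
    exact (hG.2 a b hab).2 ⟨_, key a ha, key b hb⟩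
  · exact (hG.2 a b hab).2 ⟨_, ha.2, hb.2⟩
  · have meet : ∀ u v, A.Precedes u v → (A.arc u ∩ A.arc v).Nonempty := fun u v h =>
      ⟨_, h.2, A.ccp_mem_arc v⟩
    have self : ∀ u, (A.arc u ∩ A.arc u).Nonempty := fun u =>
      ⟨_, A.ccp_mem_arc u, A.ccp_mem_arc u⟩
    obtain ⟨x, hx⟩ := hH {a, b, c} (by
      rintro u (rfl | rfl | rfl) v (rfl | rfl | rfl)
      exacts [self _, meet _ _ hab, Set.inter_comm _ _ ▸ meet _ _ hca,
        Set.inter_comm _ _ ▸ meet _ _ hab, self _, meet _ _ hbc, meet _ _ hca,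
        Set.inter_comm _ _ ▸ meet _ _ hbc, self _])
    simp only [Set.mem_insert_iff, Set.mem_singleton_iff, Set.iInter_iInter_eq_or_left,
      Set.iInter_iInter_eq_left, Set.mem_inter_iff] at hx
    obtain ⟨ha, hb, hc⟩ := hx
    induction x using QuotientAddGroup.induction_on with
    | H x =>
      obtain ⟨i, ha₁, ha₂⟩ := A.coe_mem_arc.1 ha
      obtain ⟨j, hb₁, hb₂⟩ := A.coe_mem_arc.1 hb
      obtain ⟨k, hc₁, hc₂⟩ := A.coe_mem_arc.1 hc
      have key : ∀ u v (k l : ℤ), A.Precedes u v → A.src u ≤ x + k * A.L →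
          A.src v ≤ x + l * A.L → x + l * A.L ≤ A.src v + A.len v →
          A.src u - k * A.L < A.src v - l * A.L := by
        intro u v k l h hu hv hv'
        by_contra! hle
        refine hasymm u v h ⟨h.1.symm, ccp_mem_arc_iff.2 ⟨l - k, ?_, ?_⟩⟩ <;> push_cast <;> linarith
      have := key a b i j hab ha₁ hb₁ hb₂
      have := key b c j k hbc hb₁ hc₁ hc₂
      have := key c a k i hca hc₁ ha₁ ha₂
      linarith

end PreArcModel

namespace SimpleGraph
variable {V W : Type*} {G : SimpleGraph V} {H : SimpleGraph W}

theorem IsPHCA.of_hasInducedCopy (hG : G.IsPHCA) (h : G.HasInducedCopy H) : H.IsPHCA := by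
  obtain ⟨A, ⟨hE, hM⟩, hP, hH⟩ := hG
  obtain ⟨f, hf, hadj⟩ := h
  refine ⟨A.comap f, ⟨fun p q hpq => ?_, fun u v huv => ?_⟩, fun u v => hP (f u) (f v),
    fun S hS => ?_⟩
  · have := @hE (f p.1, p.2) (f q.1, q.2) hpq
    simp only [Prod.mk.injEq, hf.eq_iff] at this
    exact Prod.ext this.1 this.2
  · rw [← hadj, hM _ _ (hf.ne huv)]; rfl
  · have := hH (f '' S) (by
      rintro _ ⟨u, hu, rfl⟩ _ ⟨v, hv, rfl⟩
      exact hS u hu v hv)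
    rwa [Set.biInter_image] at this

theorem IsPHCA.exists_isRoundOrientation [Finite V] (hG : G.IsPHCA)
    (huniv : ∀ u v, (∀ w, w ≠ u → G.Adj u w) → (∀ w, w ≠ v → G.Adj v w) → u = v) :
    ∃ D, G.IsRoundOrientation D ∧
      ∀ f : ℕ → V, (∀ i, D (f i) (f (i + 1))) → ∀ w, ∃ i, w = f i ∨ G.Adj w (f i) := by
  obtain ⟨A, hM, hP, hH⟩ := hG
  refine ⟨A.Precedes, A.isRoundOrientation_precedes hM hP hH huniv, fun f hf w => ?_⟩
  obtain ⟨i, hi⟩ := hM.1.exists_mem_arc (fun i => (hf i).1) (fun i => (hf i).2) (A.ccp w)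
  refine ⟨i, or_iff_not_imp_left.2 fun e => ?_⟩
  exact (hM.adj_iff_precedes _ _).2 (.inr ⟨Ne.symm e, hi⟩)

end SimpleGraph

namespace SimpleGraph
variable {V : Type*} {G : SimpleGraph V} {D : V → V → Prop}

namespace IsRoundOrientation

variable (hD : G.IsRoundOrientation D)
include hD

theorem false_of_claw {c x y z : V} (hx : G.Adj c x) (hy : G.Adj c y) (hz : G.Adj c z)
    (hxy : G.CoAdj x y) (hxz : G.CoAdj x z) (hyz : G.CoAdj y z) : False := by
  have out : ∀ {a b}, G.CoAdj a b → D c a → ¬ D c b := fun h ha hb =>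
    h.2 (hD.out_clique _ _ _ ha hb h.1)
  have inn : ∀ {a b}, G.CoAdj a b → D a c → ¬ D b c := fun h ha hb =>
    h.2 (hD.in_clique _ _ _ ha hb h.1)
  rcases (hD.adj_iff _ _).1 hx with hx | hx <;> rcases (hD.adj_iff _ _).1 hy with hy | hy <;>
    rcases (hD.adj_iff _ _).1 hz with hz | hz
  exacts [out hxy hx hy, out hxy hx hy, out hxz hx hz, inn hyz hy hz, out hyz hy hz,
    inn hxz hx hz, inn hxy hx hy, inn hxy hx hy]

/-- A property of ordered triangles that is invariant under rotation and reflection, and fails for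
transitively oriented triangles, fails for all triangles. -/
theorem false_of_triangle {P : V → V → V → Prop} (hrot : ∀ a b c, P a b c → P b c a)
    (hrefl : ∀ a b c, P a b c → P c b a)
    (hP : ∀ a b c, D a b → D b c → D a c → ¬ P a b c) {a b c : V}
    (hab : G.Adj a b) (hac : G.Adj a c) (hbc : G.Adj b c) : ¬ P a b c := by
  have := hD.no_cyclic_triangle
  rcases (hD.adj_iff _ _).1 hab with hab | hab <;> rcases (hD.adj_iff _ _).1 hac with hac | hac <;>
    rcases (hD.adj_iff _ _).1 hbc with hbc | hbc <;> grind

/-- The middle vertex of a triangle has no neighbour missing both other vertices. -/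
theorem false_of_net_or_prism {a b c x y z : V}
    (hab : G.Adj a b) (hac : G.Adj a c) (hbc : G.Adj b c)
    (hax : G.Adj a x) (hby : G.Adj b y) (hcz : G.Adj c z)
    (hay : G.CoAdj a y) (haz : G.CoAdj a z) (hbx : G.CoAdj b x) (hbz : G.CoAdj b z)
    (hcx : G.CoAdj c x) (hcy : G.CoAdj c y) : False := by
  let Q := fun a b c => ∃ x, G.Adj b x ∧ G.CoAdj a x ∧ G.CoAdj c x
  have hQ : ∀ a b c, Q a b c → Q c b a := fun a b c ⟨x, h₁, h₂, h₃⟩ => ⟨x, h₁, h₃, h₂⟩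
  refine hD.false_of_triangle (P := fun a b c => Q a b c ∧ Q b c a ∧ Q c a b)
    (fun a b c h => ⟨h.2.1, h.2.2, h.1⟩)
    (fun a b c h => ⟨hQ _ _ _ h.1, hQ _ _ _ h.2.2, hQ _ _ _ h.2.1⟩) ?_ hab hac hbc
    ⟨⟨y, hby, hay, hcy⟩, ⟨z, hcz, hbz, haz⟩, x, hax, hcx, hbx⟩
  rintro a b c hab hbc - ⟨⟨x, h₁, h₂, h₃⟩, -⟩
  rcases (hD.adj_iff _ _).1 h₁ with h | h
  · exact h₃.2 (hD.out_clique _ _ _ hbc h h₃.1)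
  · exact h₂.2 (hD.in_clique _ _ _ hab h h₂.1)

/-- The ends of a triangle have no common neighbour missing the middle vertex. -/
theorem false_of_tent {a b c x y z : V}
    (hab : G.Adj a b) (hac : G.Adj a c) (hbc : G.Adj b c)
    (hbx : G.Adj b x) (hcx : G.Adj c x) (hay : G.Adj a y) (hcy : G.Adj c y)
    (haz : G.Adj a z) (hbz : G.Adj b z)
    (hax : G.CoAdj a x) (hby : G.CoAdj b y) (hcz : G.CoAdj c z) : False := by
  let Q := fun a b c => ∃ x, G.Adj a x ∧ G.Adj c x ∧ G.CoAdj b x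
  have hQ : ∀ a b c, Q a b c → Q c b a := fun a b c ⟨x, h₁, h₂, h₃⟩ => ⟨x, h₂, h₁, h₃⟩
  refine hD.false_of_triangle (P := fun a b c => Q a b c ∧ Q b c a ∧ Q c a b)
    (fun a b c h => ⟨h.2.1, h.2.2, h.1⟩)
    (fun a b c h => ⟨hQ _ _ _ h.1, hQ _ _ _ h.2.2, hQ _ _ _ h.2.1⟩) ?_ hab hac hbc
    ⟨⟨y, hay, hcy, hby⟩, ⟨z, hbz, haz, hcz⟩, x, hcx, hbx, hax⟩
  rintro a b c hab hbc hac ⟨⟨x, h₁, h₂, h₃⟩, -⟩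
  have hxa : D x a := ((hD.adj_iff _ _).1 h₁).resolve_left fun h =>
    h₃.2 (hD.out_clique _ _ _ hab h h₃.1)
  have hcx : D c x := ((hD.adj_iff _ _).1 h₂).resolve_right fun h =>
    h₃.2 (hD.in_clique _ _ _ hbc h h₃.1)
  exact hD.no_cyclic_triangle _ _ _ hac hcx hxa

theorem false_of_wheel_four {h a b c d : V}
    (ha : G.Adj h a) (hb : G.Adj h b) (hc : G.Adj h c) (hd : G.Adj h d)
    (hab : G.Adj a b) (hbc : G.Adj b c) (hcd : G.Adj c d) (hda : G.Adj d a)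
    (hac : G.CoAdj a c) (hbd : G.CoAdj b d) : False := by
  have split : ∀ {x y}, G.Adj h x → G.Adj h y → G.CoAdj x y → D h x ∧ D y h ∨ D h y ∧ D x h := by
    intro x y hx hy hxy
    have h₁ := fun hx hy => hxy.2 (hD.out_clique h x y hx hy hxy.1)
    have h₂ := fun hx hy => hxy.2 (hD.in_clique h x y hx hy hxy.1)
    rcases (hD.adj_iff _ _).1 hx with hx | hx <;> rcases (hD.adj_iff _ _).1 hy with hy | hy <;>
      tauto
  have key : ∀ {a b c d}, D h a → D h b → D c h → D d h → G.Adj a b → G.Adj b c → G.Adj d a →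
      G.CoAdj a c → G.CoAdj b d → False := by
    intro a b c d ha hb hc hd hab hbc hda hac hbd
    have hcb := ((hD.adj_iff _ _).1 hbc).resolve_left (hD.no_cyclic_triangle _ _ _ hc hb)
    have hda := ((hD.adj_iff _ _).1 hda).resolve_right (hD.no_cyclic_triangle _ _ _ hd ha)
    rcases (hD.adj_iff _ _).1 hab with h | h
    · exact hac.2 (hD.in_clique _ _ _ h hcb hac.1)
    · exact hbd.2 (hD.in_clique _ _ _ h hda hbd.1)
  rcases split ha hc hac with ⟨h₁, h₂⟩ | ⟨h₁, h₂⟩ <;> rcases split hb hd hbd with ⟨h₃, h₄⟩ | ⟨h₃, h₄⟩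
  · exact key h₁ h₃ h₂ h₄ hab hbc hda hac hbd
  · exact key h₃ h₁ h₄ h₂ hda hab hcd hbd.symm hac
  · exact key h₃ h₁ h₄ h₂ hbc hcd hab hbd hac.symm
  · exact key h₁ h₃ h₂ h₄ hcd hda hbc hac.symm hbd.symm

theorem false_of_wheel_five {h a b c d e : V}
    (ha : G.Adj h a) (hb : G.Adj h b) (hc : G.Adj h c) (hd : G.Adj h d) (he : G.Adj h e)
    (hac : G.CoAdj a c) (hbd : G.CoAdj b d) (hce : G.CoAdj c e) (hda : G.CoAdj d a)
    (heb : G.CoAdj e b) : False := by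
  have flip : ∀ {x y}, G.Adj h x → G.Adj h y → G.CoAdj x y → (D h x ↔ ¬ D h y) := by
    intro x y hx hy hxy
    refine ⟨fun hx hy => hxy.2 (hD.out_clique h x y hx hy hxy.1), fun hny => ?_⟩
    refine ((hD.adj_iff _ _).1 hx).resolve_right fun hx => hxy.2 (hD.in_clique h x y hx ?_ hxy.1)
    exact ((hD.adj_iff _ _).1 hy).resolve_left hny
  have := flip ha hc hac
  have := flip hb hd hbd
  have := flip hc he hce
  have := flip hd ha hda
  have := flip he hb heb
  tauto

end IsRoundOrientation

theorem _root_.ZMod.add_two_ne {n : ℕ} (hn : 4 ≤ n) (i : ZMod n) :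
    i ≠ i + 1 + 1 ∧ i ≠ i + 1 + 1 + 1 ∧ (1 : ZMod n) ≠ 0 := by
  have hnat : ∀ k : ℕ, 0 < k → k < n → (k : ZMod n) ≠ 0 := fun k h h' e =>
    (Nat.le_of_dvd h ((ZMod.natCast_eq_zero_iff k n).1 e)).not_gt h'
  have h1 := hnat 1 (by omega) (by omega)
  have h2 := hnat 2 (by omega) (by omega)
  have h3 := hnat 3 (by omega) (by omega)
  push_cast at h1 h2 h3
  exact ⟨fun e => h2 (by linear_combination -e), fun e => h3 (by linear_combination -e), h1⟩

theorem wheelG_eq_of_universal {n : ℕ} (hn : 4 ≤ n) (u v : Option (ZMod n))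
    (hu : ∀ w, w ≠ u → (wheelG n).Adj u w) (hv : ∀ w, w ≠ v → (wheelG n).Adj v w) : u = v := by
  have key : ∀ i : ZMod n, ¬ ∀ w, w ≠ some i → (wheelG n).Adj (some i) w := by
    intro i h
    obtain ⟨h₁, h₂, h₃⟩ := ZMod.add_two_ne hn i
    have := h (some (i + 1 + 1)) (by simpa using h₁.symm)
    simp [wheelG, h₂, h₃] at this
  rcases u with _ | u
  · rcases v with _ | v
    · rfl
    · exact (key v hv).elim
  · exact (key u hu).elim

/-- If directed sequences dominate the graph, there is no hole with an isolated vertex. -/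
theorem false_of_isRoundOrientation_cycleStarG {n : ℕ} (hn : 4 ≤ n)
    {D : Option (ZMod n) → Option (ZMod n) → Prop}
    (hD : (cycleStarG n).IsRoundOrientation D)
    (hdom : ∀ f : ℕ → Option (ZMod n), (∀ i, D (f i) (f (i + 1))) →
      ∀ w, ∃ i, w = f i ∨ (cycleStarG n).Adj w (f i)) : False := by
  have h1 : (1 : ZMod n) ≠ 0 := (ZMod.add_two_ne hn 0).2.2
  have hco : ∀ i : ZMod n, (cycleStarG n).CoAdj (some i) (some (i + 1 + 1)) := by
    intro i
    obtain ⟨h, h', h''⟩ := ZMod.add_two_ne hn i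
    simpa [CoAdj, cycleStarG] using ⟨h, fun _ => ⟨h', h''⟩⟩
  have hadj : ∀ i : ZMod n, D (some i) (some (i + 1)) ∨ D (some (i + 1)) (some i) := fun i =>
    (hD.adj_iff _ _).1 (by simp [cycleStarG, h1])
  have hin : ∀ i : ZMod n, D (some i) (some (i + 1)) → ¬ D (some (i + 1 + 1)) (some (i + 1)) :=
    fun i h h' => (hco i).2 (hD.in_clique _ _ _ h h' (hco i).1)
  have hnone : ∀ g : ℕ → ZMod n, ¬ ∀ i, D (some (g i)) (some (g (i + 1))) := by
    intro g hg
    obtain ⟨i, h | h⟩ := hdom (fun i => some (g i)) hg none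
    · simp at h
    · simp [cycleStarG] at h
  rcases hadj 0 with h | h
  · refine hnone (fun k => k) fun k => ?_
    induction k with
    | zero => simpa using h
    | succ k ih =>
      push_cast at ih ⊢
      exact (hadj _).resolve_right (hin _ ih)
  · refine hnone (fun k => 1 - k) fun k => ?_
    induction k with
    | zero => simpa using h
    | succ k ih =>
      obtain ⟨i, hi⟩ : ∃ i : ZMod n, 1 - ((k + 1 + 1 : ℕ) : ZMod n) = i := ⟨_, rfl⟩
      have h₁ : 1 - ((k + 1 : ℕ) : ZMod n) = i + 1 := by rw [← hi]; push_cast; ring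
      have h₀ : 1 - (k : ZMod n) = i + 1 + 1 := by rw [← hi]; push_cast; ring
      rw [h₀, h₁] at ih
      rw [h₁, hi]
      exact (hadj i).resolve_left fun h => hin i h ih

theorem IsPHCA.forbiddenFree [Finite V] (hG : G.IsPHCA) : G.ForbiddenFree where
  claw h := by
    obtain ⟨D, hD, -⟩ := (hG.of_hasInducedCopy h).exists_isRoundOrientation (by
      simp only [clawGraph, fromRel_adj]; decide)
    exact hD.false_of_claw (c := 0) (x := 1) (y := 2) (z := 3) (by simp [clawGraph])
      (by simp [clawGraph]) (by simp [clawGraph]) (by simp [clawGraph, CoAdj])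
      (by simp [clawGraph, CoAdj]) (by simp [clawGraph, CoAdj])
  tent h := by
    obtain ⟨D, hD, -⟩ := (hG.of_hasInducedCopy h).exists_isRoundOrientation (by
      simp only [tentGraph, fromRel_adj]; decide)
    refine hD.false_of_tent (a := 0) (b := 1) (c := 2) (x := 3) (y := 4) (z := 5) ?_ ?_ ?_ ?_ ?_ ?_
      ?_ ?_ ?_ ?_ ?_ ?_ <;> simp [tentGraph, CoAdj]
  net h := by
    obtain ⟨D, hD, -⟩ := (hG.of_hasInducedCopy h).exists_isRoundOrientation (by
      simp only [netGraph, fromRel_adj]; decide)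
    refine hD.false_of_net_or_prism (a := 0) (b := 1) (c := 2) (x := 3) (y := 4) (z := 5) ?_ ?_ ?_
      ?_ ?_ ?_ ?_ ?_ ?_ ?_ ?_ ?_ <;> simp [netGraph, CoAdj]
  wheel_four h := by
    obtain ⟨D, hD, -⟩ := (hG.of_hasInducedCopy h).exists_isRoundOrientation
      (wheelG_eq_of_universal (by norm_num))
    refine hD.false_of_wheel_four (h := none) (a := some 0) (b := some 1) (c := some 2)
      (d := some 3) ?_ ?_ ?_ ?_ ?_ ?_ ?_ ?_ ?_ ?_ <;> simp [wheelG, CoAdj] <;> decide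
  wheel_five h := by
    obtain ⟨D, hD, -⟩ := (hG.of_hasInducedCopy h).exists_isRoundOrientation
      (wheelG_eq_of_universal (by norm_num))
    refine hD.false_of_wheel_five (h := none) (a := some 0) (b := some 1) (c := some 2)
      (d := some 3) (e := some 4) ?_ ?_ ?_ ?_ ?_ ?_ ?_ ?_ ?_ ?_ <;> simp [wheelG, CoAdj] <;> decide
  prism h := by
    obtain ⟨D, hD, -⟩ := (hG.of_hasInducedCopy h).exists_isRoundOrientation (by
      simp only [cycleG, compl_adj, fromRel_adj]; decide)
    refine hD.false_of_net_or_prism (a := 0) (b := 2) (c := 4) (x := 3) (y := 5) (z := 1) ?_ ?_ ?_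
      ?_ ?_ ?_ ?_ ?_ ?_ ?_ ?_ ?_ <;> simp [cycleG, CoAdj] <;> decide
  cycleStar n hn h := by
    have : NeZero n := ⟨by omega⟩
    obtain ⟨D, hD, hdom⟩ := (hG.of_hasInducedCopy h).exists_isRoundOrientation (by
      have h₁ : ∀ u, ¬ ∀ w, w ≠ u → (cycleStarG n).Adj u w := by
        rintro (_ | u) h
        · simpa [cycleStarG] using h (some 0)
        · simpa [cycleStarG] using h none
      exact fun u _ h => (h₁ u h).elim)
    exact false_of_isRoundOrientation_cycleStarG hn hD hdom

end SimpleGraph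

/-- A finite graph is a proper Helly circular-arc graph iff it contains
no induced claw, tent `S_3`, net, `W_4`, `W_5`, complement of `C_6`, or `C*_n` for
`n ≥ 4`. -/
theorem stmt17 {V : Type*} [Fintype V] (G : SimpleGraph V) :
    G.IsPHCA ↔
      (¬ G.HasInducedCopy clawGraph ∧ ¬ G.HasInducedCopy tentGraph ∧
       ¬ G.HasInducedCopy netGraph ∧ ¬ G.HasInducedCopy (wheelG 4) ∧
       ¬ G.HasInducedCopy (wheelG 5) ∧ ¬ G.HasInducedCopy (cycleG 6)ᶜ ∧
       ∀ n : ℕ, 4 ≤ n → ¬ G.HasInducedCopy (cycleStarG n)) := by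
  exact ⟨fun h => have h := h.forbiddenFree
    ⟨h.claw, h.tent, h.net, h.wheel_four, h.wheel_five, h.prism, h.cycleStar⟩,
    fun ⟨h₁, h₂, h₃, h₄, h₅, h₆, h₇⟩ =>
      SimpleGraph.ForbiddenFree.isPHCA ⟨h₁, h₂, h₃, h₄, h₅, h₆, h₇⟩⟩
end

section
/- Every finite graph that admits a proper interval model admits a unit interval model; that is, proper interval graphs and unit interval graphs are the same class of graphs. -/
/-- A family of closed intervals on the real line, one per vertex. -/
structure IntervalModel (V : Type*) where
  lo : V → ℝ
  hi : V → ℝ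
  lo_lt_hi : ∀ v, lo v < hi v

namespace IntervalModel

variable {V : Type*}

/-- `M` is an interval model of `G`: all endpoints are pairwise distinct and two
distinct vertices are adjacent iff their intervals intersect. -/
def IsModelOf (M : IntervalModel V) (G : SimpleGraph V) : Prop :=
  Function.Injective (fun p : V × Bool => if p.2 then M.hi p.1 else M.lo p.1) ∧
  ∀ u v : V, u ≠ v →
    (G.Adj u v ↔ (Set.Icc (M.lo u) (M.hi u) ∩ Set.Icc (M.lo v) (M.hi v)).Nonempty)

/-- No interval is properly contained in another interval. -/
def Proper (M : IntervalModel V) : Prop :=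
  ∀ u v : V, ¬ Set.Icc (M.lo u) (M.hi u) ⊂ Set.Icc (M.lo v) (M.hi v)

/-- Every interval has length one. -/
def Unit (M : IntervalModel V) : Prop := ∀ v, M.hi v - M.lo v = 1

end IntervalModel

namespace IntervalModel

variable {V : Type*}

/-- In terms of endpoints: two intervals meet iff each starts before the other ends. -/
theorem inter_nonempty_iff (M : IntervalModel V) (u v : V) :
    (Set.Icc (M.lo u) (M.hi u) ∩ Set.Icc (M.lo v) (M.hi v)).Nonempty ↔
      M.lo u ≤ M.hi v ∧ M.lo v ≤ M.hi u := by
  have hu := M.lo_lt_hi u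
  have hv := M.lo_lt_hi v
  rw [Set.Icc_inter_Icc, Set.nonempty_Icc, sup_le_iff, le_inf_iff, le_inf_iff]
  exact ⟨fun h => ⟨h.1.2, h.2.1⟩, fun h => ⟨⟨hu.le, h.1⟩, h.2, hv.le⟩⟩

/-- In a proper model, right endpoints are ordered as left endpoints. -/
theorem Proper.hi_lt_hi {M : IntervalModel V} (hM : M.Proper) {u v : V}
    (h : M.lo u < M.lo v) : M.hi u < M.hi v := by
  by_contra! hle
  exact hM v u (Set.Icc_ssubset_Icc_left ((M.lo_lt_hi u).le) h hle)

theorem Unit.proper {M : IntervalModel V} (hM : M.Unit) : M.Proper := by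
  intro u v h
  obtain ⟨h₁, h₂⟩ := (Set.Icc_subset_Icc_iff (M.lo_lt_hi u).le).1 h.subset
  have hu := hM u
  have hv := hM v
  refine h.ne ?_
  rw [show M.lo u = M.lo v by linarith, show M.hi u = M.hi v by linarith]

/-- The endpoints of a proper model, restricted to finitely many vertices, can be moved to
the endpoints of unit intervals without changing their relative order. -/
theorem Proper.exists_unit_left_endpoints {M : IntervalModel V} (hM : M.Proper)
    (hlo : Function.Injective M.lo) (s : Finset V) :
    ∃ p : V → ℝ, ∀ u ∈ s, ∀ v ∈ s,
      (M.lo u < M.lo v → p u < p v) ∧ (M.lo v < M.hi u → p v < p u + 1) ∧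
        (M.hi u < M.lo v → p u + 1 < p v) := by
  classical
  induction s using Finset.induction_on_max_value M.lo with
  | empty => exact ⟨0, by simp⟩
  | insert a s ha hmax ih =>
    obtain ⟨p, hp⟩ := ih
    obtain ⟨x, hlow, hupp⟩ := Order.exists_between_finsets
      (lo := ({u ∈ s | M.lo u < M.lo a}).image p ∪
        ({u ∈ s | M.hi u < M.lo a}).image (fun u => p u + 1))
      (hi := ({u ∈ s | M.lo a < M.hi u}).image (fun u => p u + 1)) (by
        intro y hy z hz
        simp only [Finset.mem_union, Finset.mem_image, Finset.mem_filter] at hy hz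
        obtain ⟨w, ⟨hw, hw'⟩, rfl⟩ := hz
        rcases hy with ⟨u, ⟨hu, hu'⟩, rfl⟩ | ⟨u, ⟨hu, hu'⟩, rfl⟩
        · exact (hp w hw u hu).2.1 (hu'.trans hw')
        · have huw : M.lo u < M.lo w := by
            by_contra! h
            rcases h.lt_or_eq with h | h
            · linarith [hM.hi_lt_hi h]
            · obtain rfl := hlo h
              linarith
          linarith [(hp u hu w hw).1 huw])
    simp only [Finset.mem_union, Finset.mem_image, Finset.mem_filter] at hlow hupp
    have ne : ∀ u ∈ s, u ≠ a := fun u hu h => ha (h ▸ hu)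
    refine ⟨Function.update p a x, fun u hu' v hv' => ?_⟩
    rcases Finset.mem_insert.1 hu' with rfl | hu <;> rcases Finset.mem_insert.1 hv' with rfl | hv
    · have := M.lo_lt_hi v
      exact ⟨fun h => (lt_irrefl _ h).elim, fun _ => lt_add_one _, fun h => by linarith⟩
    · have hvu := lt_of_le_of_ne (hmax v hv) fun h => ne v hv (hlo h)
      have hx := hlow (p v) (Or.inl ⟨v, ⟨hv, hvu⟩, rfl⟩)
      have := M.lo_lt_hi u
      rw [Function.update_self, Function.update_of_ne (ne v hv)]
      refine ⟨fun h => ?_, fun _ => ?_, fun h => ?_⟩ <;> linarith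
    · have huv := lt_of_le_of_ne (hmax u hu) fun h => ne u hu (hlo h)
      rw [Function.update_self, Function.update_of_ne (ne u hu)]
      exact ⟨fun _ => hlow _ (Or.inl ⟨u, ⟨hu, huv⟩, rfl⟩), fun h => hupp _ ⟨u, ⟨hu, h⟩, rfl⟩,
        fun h => hlow _ (Or.inr ⟨u, ⟨hu, h⟩, rfl⟩)⟩
    · rw [Function.update_of_ne (ne u hu), Function.update_of_ne (ne v hv)]
      exact hp u hu v hv

end IntervalModel

/-- A finite graph admits a proper interval model iff it admits a unit
interval model: proper interval graphs and unit interval graphs coincide. -/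
theorem stmt18 {V : Type*} [Fintype V] (G : SimpleGraph V) :
    (∃ M : IntervalModel V, M.IsModelOf G ∧ M.Proper) ↔
    (∃ M : IntervalModel V, M.IsModelOf G ∧ M.Unit) := by
  refine ⟨?_, fun ⟨M, hG, hM⟩ => ⟨M, hG, hM.proper⟩⟩
  rintro ⟨M, ⟨hinj, hG⟩, hM⟩
  have hlo : Function.Injective M.lo := fun u v h =>
    congrArg Prod.fst (@hinj (u, false) (v, false) (by simpa using h))
  have hne : ∀ u v, M.lo v ≠ M.hi u := fun u v h => by
    have := @hinj (v, false) (u, true) (by simpa using h)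
    simp at this
  obtain ⟨p, hp⟩ := hM.exists_unit_left_endpoints hlo Finset.univ
  have hmono : ∀ u v, M.lo u < M.lo v → p u < p v := fun u v =>
    (hp u (Finset.mem_univ u) v (Finset.mem_univ v)).1
  have hmeet : ∀ u v, M.lo v < M.hi u → p v < p u + 1 := fun u v =>
    (hp u (Finset.mem_univ u) v (Finset.mem_univ v)).2.1
  have hmiss : ∀ u v, M.hi u < M.lo v → p u + 1 < p v := fun u v =>
    (hp u (Finset.mem_univ u) v (Finset.mem_univ v)).2.2
  have hpinj : Function.Injective p := fun u v h => hlo <| by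
    by_contra hne
    rcases lt_or_gt_of_ne hne with h' | h'
    · exact (hmono u v h').ne h
    · exact (hmono v u h').ne' h
  have hpne : ∀ u v, p v ≠ p u + 1 := fun u v =>
    (lt_or_gt_of_ne (hne u v)).elim (fun h => (hmeet u v h).ne) fun h => (hmiss u v h).ne'
  have hiff : ∀ u v, M.lo v ≤ M.hi u ↔ p v ≤ p u + 1 := fun u v =>
    ⟨fun h => (hmeet u v (lt_of_le_of_ne h (hne u v))).le,
      fun h => not_lt.1 fun h' => (hmiss u v h').not_ge h⟩
  refine ⟨⟨p, fun v => p v + 1, fun v => lt_add_one (p v)⟩, ⟨?_, fun u v huv => ?_⟩,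
    fun v => add_sub_cancel_left (p v) 1⟩
  · rintro ⟨u, _ | _⟩ ⟨v, _ | _⟩ h
    · simpa using hpinj (by simpa using h)
    · exact (hpne v u (by simpa using h)).elim
    · exact (hpne u v (by simpa using h.symm)).elim
    · simpa using hpinj (by simpa using h)
  · rw [hG u v huv, IntervalModel.inter_nonempty_iff, IntervalModel.inter_nonempty_iff,
      hiff, hiff]
end
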